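/- Let f belong to F(p,rho), and let g be the Hilbert function of a closed projective subscheme Z with Hilbert polynomial Delta p(z) such that g(t) <= Delta f(t) for all t. Then there exists a closed projective subscheme X with Hilbert function f and Castelnuovo-Mumford regularity reg(X) = max{reg(Z), rho+1}. Equivalently, in ideal-theoretic form: for every saturated strongly stable ideal J' of K[x_1,...,x_n] whose quotient has Hilbert function g, there exist n' and a saturated strongly stable ideal I of K[x_0,...,x_{n'}] whose quotient has Hilbert function f and with reg(I) = max{reg(J'), rho+1}. -/

import Mathlib

open scoped Classical

noncomputable section

/-! ## Binomial expansions and the Macaulay operations `(a_t)^+_+` and `(a_t)^-_-` -/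

/-- The largest `k` such that `C(k,t) ≤ a` (top coefficient of the greedy binomial
expansion of `a` in base `t`). -/
def expTop (a t : ℕ) : ℕ := Nat.findGreatest (fun k => Nat.choose k t ≤ a) (a + t + 1)

/-- `(a_t)^+_+` : if `a = C(k(t),t) + ... + C(k(j),j)` is the binomial expansion of `a`
in base `t`, then `plusPlus a t = C(k(t)+1,t+1) + ... + C(k(j)+1,j+1)`; it sends `0` to `0`. -/
def plusPlus : ℕ → ℕ → ℕ
  | _, 0 => 0
  | a, t + 1 =>
    if a = 0 then 0
    else Nat.choose (expTop a (t + 1) + 1) (t + 2) +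
      plusPlus (a - Nat.choose (expTop a (t + 1)) (t + 1)) t

/-- `(a_t)^-_-` : if `a = C(k(t),t) + ... + C(k(j),j)` is the binomial expansion of `a`
in base `t`, then `minusMinus a t = C(k(t)-1,t-1) + ... + C(k(j)-1,j-1)`; it sends `0` to `0`. -/
def minusMinus : ℕ → ℕ → ℕ
  | _, 0 => 0
  | a, t + 1 =>
    if a = 0 then 0
    else Nat.choose (expTop a (t + 1) - 1) t +
      minusMinus (a - Nat.choose (expTop a (t + 1)) (t + 1)) t

/-! ## Numerical functions -/

/-- A numerical function (modelled with values in `ℤ`) is *admissible* (an O-sequence) if it is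
nonnegative, `H 0 = 1` and `H (t+1) ≤ (H(t)_t)^+_+` for every `t ≥ 1`. -/
def OSeq (H : ℕ → ℤ) : Prop :=
  (∀ t, 0 ≤ H t) ∧ H 0 = 1 ∧ ∀ t, 1 ≤ t → H (t + 1) ≤ (plusPlus (H t).toNat t : ℤ)

/-- First derivative of a numerical function: `Δf(0) = 1`, `Δf(t) = f(t) - f(t-1)`. -/
def nderiv (f : ℕ → ℤ) : ℕ → ℤ
  | 0 => 1
  | t + 1 => f (t + 1) - f t

/-- Integral of a numerical function: `Σg(0) = 1`, `Σg(t) = Σg(t-1) + g(t)`. -/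
def ninteg (g : ℕ → ℤ) : ℕ → ℤ
  | 0 => 1
  | t + 1 => ninteg g t + g (t + 1)

/-! ## Admissible Hilbert polynomials in Gotzmann form -/

/-- The integer-valued binomial coefficient `C(a,k)` for `a : ℤ`, agreeing with the
polynomial binomial coefficient `a(a-1)⋯(a-k+1)/k!`. -/
def zchoose (a : ℤ) (k : ℕ) : ℤ :=
  if 0 ≤ a then (a.toNat.choose k : ℤ)
  else (-1) ^ k * (((k : ℤ) - 1 - a).toNat.choose k : ℤ)

/-- An admissible Hilbert polynomial, recorded through its Gotzmann form
`p(z) = C(z+k₁,k₁) + C(z+k₂-1,k₂) + ... + C(z+k_r-(r-1),k_r)` with `k₁ ≥ k₂ ≥ ... ≥ k_r ≥ 0`. -/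
structure GotzmannPoly where
  ks : List ℕ
  sorted : ks.Pairwise (· ≥ ·)

namespace GotzmannPoly

/-- The Gotzmann number `r` of `p`. -/
def r (p : GotzmannPoly) : ℕ := p.ks.length

/-- The degree of `p`, namely `k₁`. -/
def degree (p : GotzmannPoly) : ℕ := p.ks.headD 0

/-- Evaluation of `p` at an integer. -/
def eval (p : GotzmannPoly) (z : ℤ) : ℤ :=
  ∑ i ∈ Finset.range p.r, zchoose (z + (p.ks.getD i 0 : ℤ) - i) (p.ks.getD i 0)

/-- The first difference `Δp(z) = p(z) - p(z-1)`, in Gotzmann form. -/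
def delta (p : GotzmannPoly) : GotzmannPoly where
  ks := (p.ks.filter fun k => 1 ≤ k).map fun k => k - 1
  sorted := by
    refine List.Pairwise.map _ (fun {a b} h => Nat.sub_le_sub_right h 1) ?_
    exact p.sorted.filter _

/-- Iterated first difference `Δ^i p`. -/
def deltaIter (p : GotzmannPoly) (i : ℕ) : GotzmannPoly := delta^[i] p

/-- The polynomial `p(z) + c`, in Gotzmann form. -/
def addConst (p : GotzmannPoly) (c : ℕ) : GotzmannPoly where
  ks := p.ks ++ List.replicate c 0
  sorted := by
    rw [List.pairwise_append]
    refine ⟨p.sorted, ?_, ?_⟩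
    · exact List.pairwise_replicate.2 (Or.inr le_rfl)
    · intro a _ b hb
      rw [List.eq_of_mem_replicate hb]
      exact Nat.zero_le a

end GotzmannPoly

/-- The set `Π_p = {1 ≤ t ≤ r : (p(t+h)_{t+h})^+_+ ≥ p(t+h+1) ≥ 1 for all h ≥ 0}`. -/
def PiSet (p : GotzmannPoly) : Set ℕ :=
  {t | 1 ≤ t ∧ t ≤ p.r ∧ ∀ h : ℕ,
      p.eval ((t : ℤ) + (h : ℤ) + 1) ≤ (plusPlus (p.eval ((t : ℤ) + (h : ℤ))).toNat (t + h) : ℤ) ∧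
      1 ≤ p.eval ((t : ℤ) + (h : ℤ) + 1)}

/-- `ρ_p`: `0` if `min Π_p = 1` and `p(0) = 1`, and `min Π_p` otherwise. -/
def rhoP (p : GotzmannPoly) : ℕ :=
  if sInf (PiSet p) = 1 ∧ p.eval 0 = 1 then 0 else sInf (PiSet p)

/-- The minimal function `f^ρ_p` : `f(t) = p(t)` for `t ≥ ρ` and
`f(t) = ((f(t+1))_{t+1})^-_-` for `t < ρ`. -/
def fmin (p : GotzmannPoly) (ρ : ℕ) (t : ℕ) : ℤ :=
  if h : ρ ≤ t then p.eval (t : ℤ)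
  else (minusMinus (fmin p ρ (t + 1)).toNat (t + 1) : ℤ)
termination_by ρ - t
decreasing_by omega

/-- The function `g^ρ_p` : `g(t) = p(t)` for `t ≥ ρ`, `g(ρ-1) = p(ρ-1) + 1` and
`g(t) = ((g(t+1))_{t+1})^-_-` for `t < ρ-1`. -/
def gmin (p : GotzmannPoly) (ρ : ℕ) (t : ℕ) : ℤ :=
  if h : ρ ≤ t then p.eval (t : ℤ)
  else if t = ρ - 1 then p.eval (t : ℤ) + 1
  else (minusMinus (gmin p ρ (t + 1)).toNat (t + 1) : ℤ)
termination_by ρ - t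
decreasing_by omega

/-- `H` has regularity `ρ` (with respect to the Hilbert polynomial `p`): `ρ` is the least
integer such that `H(t) = p(t)` for all `t ≥ ρ`. -/
def IsRegOf (p : GotzmannPoly) (H : ℕ → ℤ) (ρ : ℕ) : Prop :=
  (∀ t : ℕ, ρ ≤ t → H t = p.eval (t : ℤ)) ∧
  ∀ ρ' : ℕ, (∀ t : ℕ, ρ' ≤ t → H t = p.eval (t : ℤ)) → ρ ≤ ρ'

/-- `H` has Hilbert polynomial `p`, i.e. eventually agrees with `p`. -/
def HasHP (p : GotzmannPoly) (H : ℕ → ℤ) : Prop :=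
  ∃ N : ℕ, ∀ t : ℕ, N ≤ t → H t = p.eval (t : ℤ)

/-- `F(p,ρ)`: the set of Hilbert functions of closed projective subschemes (i.e. numerical
functions which are admissible together with their first derivative) with Hilbert
polynomial `p` and regularity `ρ`. -/
def Fset (p : GotzmannPoly) (ρ : ℕ) : Set (ℕ → ℤ) :=
  {H | OSeq H ∧ OSeq (nderiv H) ∧ IsRegOf p H ρ}

/-- `ρ̄_p`: the minimal `ρ` such that `F(p,ρ)` is non-empty. -/
def rhobar (p : GotzmannPoly) : ℕ := sInf {ρ | (Fset p ρ).Nonempty}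

/-! ## Monomial ideals in `K[x₀,…,xₙ]` (combinatorial model) -/

/-- Monomials of `K[x₀,…,xₙ]`, as exponent vectors. -/
abbrev Mon (n : ℕ) := Fin (n + 1) → ℕ

/-- Degree of a monomial. -/
def mdeg {n : ℕ} (m : Mon n) : ℕ := ∑ i, m i

/-- `T_t`, the set of terms of degree `t`. -/
def Tset (n t : ℕ) : Set (Mon n) := {m | mdeg m = t}

/-- A set of monomials closed under multiplication by arbitrary monomials (a monomial ideal). -/
def MonIdeal {n : ℕ} (J : Set (Mon n)) : Prop :=
  ∀ m ∈ J, ∀ m' : Mon n, m + m' ∈ J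

/-- The elementary Borel move sending `x^m` to `x_i · x^m / x_j`. -/
def borelStep {n : ℕ} (m : Mon n) (j i : Fin (n + 1)) : Mon n :=
  fun l => if l = j then m l - 1 else if l = i then m l + 1 else m l

/-- One elementary Borel move `x_j ↦ x_i` with `j < i`. -/
def borelMove {n : ℕ} (a b : Mon n) : Prop :=
  ∃ j i : Fin (n + 1), j < i ∧ 1 ≤ a j ∧ b = borelStep a j i

/-- The Borel (partial) order `≤_B` on monomials. -/
def borelLE {n : ℕ} : Mon n → Mon n → Prop := Relation.ReflTransGen borelMove

/-- A strongly stable (Borel) monomial ideal. -/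
def StronglyStable {n : ℕ} (J : Set (Mon n)) : Prop :=
  MonIdeal J ∧ ∀ m ∈ J, ∀ j i : Fin (n + 1), j < i → 1 ≤ m j → borelStep m j i ∈ J

/-- A Borel set in `T_t`: a set of degree-`t` monomials closed upwards under `≤_B`. -/
def IsBorelSet {n : ℕ} (t : ℕ) (B : Set (Mon n)) : Prop :=
  B ⊆ Tset n t ∧ ∀ a ∈ B, ∀ b : Mon n, borelLE a b → b ∈ B

/-- Saturation of a monomial ideal:
`J^sat = {m : for every i there is k with x_i^k · m ∈ J}`. -/
def monSat {n : ℕ} (J : Set (Mon n)) : Set (Mon n) :=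
  {m | ∀ i : Fin (n + 1), ∃ k : ℕ, (fun l => if l = i then m l + k else m l) ∈ J}

/-- The monomial ideal generated by a set of monomials. -/
def genIdeal {n : ℕ} (B : Set (Mon n)) : Set (Mon n) :=
  {m | ∃ b ∈ B, ∃ c : Mon n, m = b + c}

/-- The Hilbert function of `S/J` for a monomial ideal `J`: the number of degree-`t`
monomials outside `J`. -/
def hilb {n : ℕ} (J : Set (Mon n)) (t : ℕ) : ℕ :=
  Set.ncard {m : Mon n | mdeg m = t ∧ m ∉ J}

/-- `m / x_i` as an exponent vector. -/
def shrinkAt {n : ℕ} (m : Mon n) (i : Fin (n + 1)) : Mon n :=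
  fun l => if l = i then m l - 1 else m l

/-- `m` is a minimal (monomial) generator of the monomial ideal `J`. -/
def IsMinGen {n : ℕ} (J : Set (Mon n)) (m : Mon n) : Prop :=
  m ∈ J ∧ ∀ i : Fin (n + 1), 1 ≤ m i → shrinkAt m i ∉ J

/-- The Castelnuovo–Mumford regularity of a strongly stable ideal: the maximal degree of a
minimal monomial generator. -/
def monReg {n : ℕ} (J : Set (Mon n)) : ℕ :=
  sSup {d | ∃ m : Mon n, IsMinGen J m ∧ mdeg m = d}

/-- `m_u`: the minimal Castelnuovo–Mumford regularity of a closed projective subscheme with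
Hilbert function `u`, i.e. the minimum of `reg J` over all `n` and all saturated strongly
stable ideals `J ⊆ K[x₀,…,xₙ]` with `H_{S/J} = u`. -/
def mReg (u : ℕ → ℤ) : ℕ :=
  sInf {r | ∃ (n : ℕ) (J : Set (Mon n)), StronglyStable J ∧ monSat J = J ∧
      (∀ t : ℕ, (hilb J t : ℤ) = u t) ∧ monReg J = r}

/-- `M(p,ρ) = {m_u : u ∈ F(p,ρ)}`. -/
def Mset (p : GotzmannPoly) (ρ : ℕ) : Set ℕ := {r | ∃ u ∈ Fset p ρ, mReg u = r}

/-- `m^ρ_p = min M(p,ρ)`. -/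
def mRho (p : GotzmannPoly) (ρ : ℕ) : ℕ := sInf (Mset p ρ)

/-- `m_p`: the minimal Castelnuovo–Mumford regularity of schemes with Hilbert polynomial `p`. -/
def mP (p : GotzmannPoly) : ℕ := sInf {r | ∃ ρ : ℕ, ∃ u ∈ Fset p ρ, mReg u = r}

/-! ## Lex segments and growth-height-lexicographic Borel sets -/

/-- `a` is smaller than `b` in the deglex order (for monomials of the same degree):
`a k < b k` where `k` is the largest index where they differ. -/
def deglexLT {n : ℕ} (a b : Mon n) : Prop :=
  ∃ k : Fin (n + 1), a k < b k ∧ ∀ l : Fin (n + 1), k < l → a l = b l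

/-- A lex-segment of `T_t`: a set of degree-`t` monomials consisting of the highest terms
with respect to deglex. -/
def IsLexSeg {n : ℕ} (t : ℕ) (L : Set (Mon n)) : Prop :=
  L ⊆ Tset n t ∧ ∀ a ∈ L, ∀ b ∈ Tset n t, deglexLT a b → b ∈ L

/-- A lex-segment in `A ⊆ T_t`: the intersection of a lex-segment of `T_t` with `A`. -/
def LexSegIn {n : ℕ} (t : ℕ) (A S : Set (Mon n)) : Prop :=
  ∃ L : Set (Mon n), IsLexSeg t L ∧ S = L ∩ A

/-- The growth class `B^{(i)} = {m ∈ B : min(m) = i}`. -/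
def growthClass {n : ℕ} (B : Set (Mon n)) (i : Fin (n + 1)) : Set (Mon n) :=
  {m | m ∈ B ∧ 1 ≤ m i ∧ ∀ j : Fin (n + 1), j < i → m j = 0}

/-- The height class `B(i) = {m ∈ B : the exponent of x₀ in m is i}`. -/
def heightClass {n : ℕ} (B : Set (Mon n)) (i : ℕ) : Set (Mon n) :=
  {m | m ∈ B ∧ m 0 = i}

/-- A Borel set `B ⊆ T_t` is growth-lexicographic if all its growth classes are lex-segments
in the corresponding growth classes of `T_t`. -/
def GrowthLex {n : ℕ} (t : ℕ) (B : Set (Mon n)) : Prop :=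
  ∀ i : Fin (n + 1), LexSegIn t (growthClass (Tset n t) i) (growthClass B i)

/-- A Borel set `B ⊆ T_t` is growth-height-lexicographic if `B(0)` is growth-lexicographic
and `B(i)` is a lex-segment in `T_t(i)` for every `0 < i ≤ t`. -/
def GHLex {n : ℕ} (t : ℕ) (B : Set (Mon n)) : Prop :=
  GrowthLex t (heightClass B 0) ∧
  ∀ i : ℕ, 0 < i → i ≤ t → LexSegIn t (heightClass (Tset n t) i) (heightClass B i)

end

/-! ## Sizes of lex segments -/

/-- The recursion step behind `lexFree`: the largest `c < a` with `c + M (c - D c) ≤ a`, where `D`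
is the function being defined. -/
noncomputable def lexFreeStep (M : ℕ → ℕ) (a : ℕ) : ℕ :=
  (Finset.range a).attach.sup fun c =>
    if c.1 + M (c.1 - lexFreeStep M c.1) ≤ a then c.1 else 0
termination_by a
decreasing_by exact Finset.mem_range.1 c.2

/-- The size of the smallest set of the form `{m ≤ w}` in degree `t` (in the lex order) that
contains exactly `c` monomials not divisible by the smallest variable. -/
noncomputable def lexLift : ℕ → ℕ → ℕ
  | 0, c => c
  | t + 1, c => c + lexLift t (c - lexFreeStep (lexLift t) c)

/-- The number of monomials not divisible by the smallest variable among the `a` lex-smallest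
monomials of degree `t`. -/
noncomputable def lexFree : ℕ → ℕ → ℕ
  | 0, a => a
  | t + 1, a => lexFreeStep (lexLift t) a

section LexFreeStep

variable {M : ℕ → ℕ}

theorem lexFreeStep_zero : lexFreeStep M 0 = 0 := by
  rw [lexFreeStep]; rfl

theorem le_lexFreeStep {a c : ℕ} (hc : c < a) (h : c + M (c - lexFreeStep M c) ≤ a) :
    c ≤ lexFreeStep M a := by
  rw [lexFreeStep]
  have := Finset.le_sup (f := fun c : {x // x ∈ Finset.range a} =>
    if c.1 + M (c.1 - lexFreeStep M c.1) ≤ a then c.1 else 0)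
    (Finset.mem_attach (Finset.range a) ⟨c, Finset.mem_range.2 hc⟩)
  simpa [h] using this

theorem lexFreeStep_spec (h0 : M 0 = 0) {a : ℕ} (ha : 0 < a) :
    lexFreeStep M a < a ∧
      lexFreeStep M a + M (lexFreeStep M a - lexFreeStep M (lexFreeStep M a)) ≤ a := by
  obtain ⟨c, -, hc⟩ := Finset.exists_mem_eq_sup (Finset.range a).attach
    ⟨⟨0, Finset.mem_range.2 ha⟩, Finset.mem_attach _ _⟩
    (fun c : {x // x ∈ Finset.range a} =>
      if c.1 + M (c.1 - lexFreeStep M c.1) ≤ a then c.1 else 0)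
  have hc' := hc
  rw [← lexFreeStep] at hc'
  have hlt := Finset.mem_range.1 c.2
  split_ifs at hc' with h
  · rw [hc']; exact ⟨hlt, h⟩
  · rw [hc', lexFreeStep_zero]; simpa [h0] using ha

theorem lexFreeStep_succ_le (h0 : M 0 = 0) (hM : StrictMono M) (a : ℕ) :
    lexFreeStep M (a + 1) ≤ lexFreeStep M a + 1 := by
  induction a using Nat.strong_induction_on with
  | _ a ih =>
    obtain ⟨h1, h2⟩ := lexFreeStep_spec h0 (Nat.succ_pos a)
    rcases hc : lexFreeStep M (a + 1) with _ | c
    · omega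
    · simp only [Nat.succ_eq_add_one, hc] at h1 h2
      have h3 := ih c (by omega)
      have h4 : M (c - lexFreeStep M c) ≤ M (c + 1 - lexFreeStep M (c + 1)) :=
        hM.monotone (by omega)
      have := le_lexFreeStep (M := M) (a := a) (c := c) (by omega) (by omega)
      omega

end LexFreeStep

theorem lexLift_zero_right (t : ℕ) : lexLift t 0 = 0 := by
  induction t with
  | zero => rfl
  | succ t ih => simp [lexLift, ih]

theorem lexLift_succ (t c : ℕ) :
    lexLift (t + 1) c = c + lexLift t (c - lexFree (t + 1) c) := rfl

theorem lexLift_strictMono (t : ℕ) : StrictMono (lexLift t) := by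
  induction t with
  | zero => exact strictMono_id
  | succ t ih =>
    refine strictMono_nat_of_lt_succ fun c => ?_
    have h := lexFreeStep_succ_le (lexLift_zero_right t) ih c
    have : lexLift t (c - lexFreeStep (lexLift t) c) ≤
        lexLift t (c + 1 - lexFreeStep (lexLift t) (c + 1)) := ih.monotone (by omega)
    simp only [lexLift]
    omega

theorem lexFree_zero_right (t : ℕ) : lexFree t 0 = 0 := by
  cases t with
  | zero => rfl
  | succ t => exact lexFreeStep_zero

theorem lexFree_lt (t : ℕ) {a : ℕ} (ha : 0 < a) : lexFree (t + 1) a < a :=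
  (lexFreeStep_spec (lexLift_zero_right t) ha).1

theorem le_lexFree_iff (t c a : ℕ) : c ≤ lexFree t a ↔ lexLift t c ≤ a := by
  cases t with
  | zero => rfl
  | succ t =>
    rcases Nat.eq_zero_or_pos a with rfl | ha
    · rw [lexFree_zero_right, Nat.le_zero, Nat.le_zero]
      refine ⟨fun h => by rw [h, lexLift_zero_right], fun h => ?_⟩
      rw [lexLift] at h; omega
    · have h := lexFreeStep_spec (lexLift_zero_right t) ha
      refine ⟨fun hc => ((lexLift_strictMono (t + 1)).monotone hc).trans h.2, fun hc => ?_⟩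
      rcases Nat.eq_zero_or_pos c with rfl | hc0
      · exact Nat.zero_le _
      · refine le_lexFreeStep ?_ hc
        have h1 := lexFree_lt t hc0
        have h2 := (lexLift_strictMono t).le_apply (x := c - lexFree (t + 1) c)
        rw [lexLift_succ] at hc
        omega

theorem lexFree_gc (t : ℕ) : GaloisConnection (lexLift t) (lexFree t) :=
  fun c a => (le_lexFree_iff t c a).symm

theorem lexFree_mono (t : ℕ) : Monotone (lexFree t) := (lexFree_gc t).monotone_u

theorem lexLift_lexFree_le (t a : ℕ) : lexLift t (lexFree t a) ≤ a := (lexFree_gc t).l_u_le a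

theorem lexFree_le (t a : ℕ) : lexFree t a ≤ a :=
  (lexLift_strictMono t).le_apply.trans (lexLift_lexFree_le t a)

theorem lexFree_succ_le (t a : ℕ) : lexFree t (a + 1) ≤ lexFree t a + 1 := by
  cases t with
  | zero => rfl
  | succ t => exact lexFreeStep_succ_le (lexLift_zero_right t) (lexLift_strictMono t) a

theorem sub_lexFree_mono (t : ℕ) : Monotone fun a => a - lexFree t a := by
  refine monotone_nat_of_le_succ fun a => ?_
  have := lexFree_succ_le t a
  omega

/-- If the part divisible by the smallest variable is large enough, then the free part of a Borel
set is bounded by the one of the lex segment of the same size. -/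
theorem le_lexFree_add {t c b : ℕ} (h : c - lexFree (t + 1) c ≤ lexFree t b) :
    c ≤ lexFree (t + 1) (c + b) := by
  rw [le_lexFree_iff] at h ⊢
  rw [lexLift_succ]
  omega

theorem sub_lexFree_lexFree_le (t a : ℕ) :
    lexFree (t + 1) a - lexFree (t + 1) (lexFree (t + 1) a) ≤
      lexFree t (a - lexFree (t + 1) a) := by
  rw [le_lexFree_iff]
  have := lexLift_lexFree_le (t + 1) a
  rw [lexLift_succ] at this
  omega

/-! ### Comparison with the Macaulay bound -/

theorem lexFree_one_right (t : ℕ) : lexFree (t + 1) 1 = 0 := by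
  have := lexFree_lt t one_pos
  omega

theorem lexLift_choose {t k : ℕ} (h : t ≤ k) :
    lexLift t (k.choose t) = (k + 1).choose t := by
  induction t generalizing k with
  | zero => simp [lexLift]
  | succ t iht =>
    induction k, h using Nat.le_induction with
    | base =>
      rw [Nat.choose_self, lexLift_succ, lexFree_one_right]
      have := iht (le_refl t)
      rw [Nat.choose_self] at this
      simp [this]; omega
    | succ k hk ihk =>
      have h1 : lexFree (t + 1) ((k + 1).choose (t + 1)) = k.choose (t + 1) := by
        refine le_antisymm ?_ ((le_lexFree_iff _ _ _).2 ihk.le)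
        by_contra hcon
        have := (le_lexFree_iff (t + 1) _ _).1 (Nat.succ_le_of_lt (not_le.1 hcon))
        have h2 := lexLift_strictMono (t + 1) (Nat.lt_succ_self (k.choose (t + 1)))
        omega
      have h2 := iht (show t ≤ k by omega)
      have h3 : (k + 1).choose (t + 1) - k.choose (t + 1) = k.choose t := by
        rw [Nat.choose_succ_succ']; omega
      rw [lexLift_succ, h1, h3, h2, Nat.choose_succ_succ' (k + 1), add_comm]

theorem lexFree_choose_succ {t k : ℕ} (h : t ≤ k + 1) :
    lexFree t ((k + 1).choose t) = k.choose t := by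
  rcases Nat.lt_or_ge k t with hlt | hge
  · obtain rfl : t = k + 1 := by omega
    rw [Nat.choose_self, lexFree_one_right, Nat.choose_succ_self]
  · have ihk := lexLift_choose hge
    refine le_antisymm ?_ ((le_lexFree_iff _ _ _).2 ihk.le)
    by_contra hcon
    have := (le_lexFree_iff t _ _).1 (Nat.succ_le_of_lt (not_le.1 hcon))
    have h2 := lexLift_strictMono t (Nat.lt_succ_self (k.choose t))
    omega

theorem lexFree_le_choose {t k x : ℕ} (h : t ≤ k + 1) (hx : x ≤ (k + 1).choose t) :
    lexFree t x ≤ k.choose t :=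
  (lexFree_mono t hx).trans (lexFree_choose_succ h).le

theorem lexFree_one_left (a : ℕ) : lexFree 1 a = a - 1 := by
  induction a with
  | zero => exact lexFree_zero_right 1
  | succ a ih =>
    refine le_antisymm ?_ ?_
    · have := lexFree_lt 0 (Nat.succ_pos a)
      simpa using Nat.le_of_lt_succ this
    · rw [le_lexFree_iff, lexLift_succ]
      simp only [Nat.add_sub_cancel, lexLift, zero_add, ih]
      omega

theorem lexLift_choose_add_le {t k x : ℕ} (hk : t ≤ k) (hx : x ≤ k.choose t) :
    lexLift (t + 1) (k.choose (t + 1) + x) ≤ (k + 1).choose (t + 1) + lexLift t x := by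
  induction t generalizing k x with
  | zero =>
    rw [lexLift_succ, zero_add, lexFree_one_left, Nat.choose_one_right, Nat.choose_one_right]
    show k + x + (k + x - (k + x - 1)) ≤ k + 1 + x
    omega
  | succ t iht =>
    induction k, hk using Nat.le_induction generalizing x with
    | base =>
      rw [Nat.choose_succ_self, Nat.choose_self, zero_add]
      rw [Nat.choose_self] at hx
      interval_cases x
      · simp [lexLift_zero_right]
      · rw [lexLift_succ, lexFree_one_right]
    | succ k hk ihk =>
      have h1 := lexFree_le_choose (show t + 1 ≤ k + 1 by omega) hx
      have h2 := ihk h1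
      have h3 := lexLift_lexFree_le (t + 1) x
      have h4 := (le_lexFree_iff (t + 1 + 1) _ _).2 (h2.trans (Nat.add_le_add_left h3 _))
      have h5 := sub_lexFree_mono (t + 1) hx
      simp only [lexFree_choose_succ (show t + 1 ≤ k + 1 by omega)] at h5
      have h6 : (k + 1).choose (t + 1) = k.choose t + k.choose (t + 1) := Nat.choose_succ_succ' _ _
      have h7 := iht (k := k) (x := x - lexFree (t + 1) x) (by omega) (by omega)
      have h8 : (k + 1).choose (t + 1 + 1) = k.choose (t + 1) + k.choose (t + 1 + 1) :=
        Nat.choose_succ_succ' _ _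
      have h9 : (k + 1 + 1).choose (t + 1 + 1) =
          (k + 1).choose (t + 1) + (k + 1).choose (t + 1 + 1) :=
        Nat.choose_succ_succ' _ _
      have h11 := lexFree_le (t + 1) x
      have h10 := (lexLift_strictMono (t + 1)).monotone
        (show (k + 1).choose (t + 1 + 1) + x -
            lexFree (t + 1 + 1) ((k + 1).choose (t + 1 + 1) + x) ≤
          k.choose (t + 1) + (x - lexFree (t + 1) x) by omega)
      rw [lexLift_succ (t + 1), lexLift_succ t x]
      omega

theorem choose_add_lexFree_le {t k y : ℕ} (hk : t ≤ k) (hy : y ≤ (k + 1).choose t) :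
    k.choose (t + 1) + lexFree t y ≤ lexFree (t + 1) ((k + 1).choose (t + 1) + y) := by
  rw [le_lexFree_iff]
  exact (lexLift_choose_add_le hk (lexFree_le_choose (by omega) hy)).trans
    (Nat.add_le_add_left (lexLift_lexFree_le t y) _)

theorem expTop_spec {a t : ℕ} (ha : a ≠ 0) :
    t + 1 ≤ expTop a (t + 1) ∧ (expTop a (t + 1)).choose (t + 1) ≤ a ∧
      a < (expTop a (t + 1) + 1).choose (t + 1) := by
  have h0 : (t + 1).choose (t + 1) ≤ a := by rw [Nat.choose_self]; omega
  have h1 : t + 1 ≤ expTop a (t + 1) := Nat.le_findGreatest (by omega) h0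
  have h2 : (expTop a (t + 1)).choose (t + 1) ≤ a :=
    Nat.findGreatest_spec (P := fun k => k.choose (t + 1) ≤ a) (m := t + 1) (by omega) h0
  refine ⟨h1, h2, ?_⟩
  by_contra hcon
  have h3 : ∀ b : ℕ, b + 1 ≤ (b + 1 + t).choose (t + 1) := by
    intro b
    induction b with
    | zero => simp [add_comm]
    | succ b ih =>
      have h4 : (b + 1 + 1 + t).choose (t + 1) =
          (b + 1 + t).choose t + (b + 1 + t).choose (t + 1) := by
        rw [show b + 1 + 1 + t = (b + 1 + t) + 1 by omega, Nat.choose_succ_succ']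
      have h5 : 0 < (b + 1 + t).choose t := Nat.choose_pos (by omega)
      omega
  by_cases hb : expTop a (t + 1) + 1 ≤ a + (t + 1) + 1
  · have : expTop a (t + 1) + 1 ≤ expTop a (t + 1) :=
      Nat.le_findGreatest (P := fun k => k.choose (t + 1) ≤ a) hb (not_lt.1 hcon)
    omega
  · have h4 := h3 a
    have h5 := Nat.choose_le_choose (t + 1) (show a + 1 + t ≤ expTop a (t + 1) by omega)
    omega

theorem plusPlus_le_choose {a t k : ℕ} (h : a < k.choose t) :
    plusPlus a t ≤ (k + 1).choose (t + 1) := by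
  induction t generalizing a k with
  | zero => simp [plusPlus]
  | succ t ih =>
    rw [plusPlus]
    split_ifs with ha
    · exact Nat.zero_le _
    · obtain ⟨-, h2, h3⟩ := expTop_spec (t := t) ha
      set e := expTop a (t + 1)
      have h4 : e < k := by
        by_contra hcon
        have := Nat.choose_le_choose (t + 1) (not_lt.1 hcon)
        omega
      rw [Nat.choose_succ_succ'] at h3
      have h5 := ih (a := a - e.choose (t + 1)) (k := e) (by omega)
      have h6 : (e + 1 + 1).choose (t + 1 + 1) =
          (e + 1).choose (t + 1) + (e + 1).choose (t + 1 + 1) :=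
        Nat.choose_succ_succ' _ _
      have h7 : (e + 1 + 1).choose (t + 1 + 1) ≤ (k + 1).choose (t + 1 + 1) :=
        Nat.choose_le_choose _ (by omega)
      show (e + 1).choose (t + 1 + 1) + _ ≤ (k + 1).choose (t + 1 + 1)
      omega

theorem plusPlus_le_add_lexFree (a t : ℕ) :
    plusPlus a t ≤ a + lexFree (t + 1) (plusPlus a t) := by
  induction t generalizing a with
  | zero => simp [plusPlus]
  | succ t ih =>
    rw [plusPlus]
    split_ifs with ha
    · exact Nat.zero_le _
    · obtain ⟨h1, h2, h3⟩ := expTop_spec (t := t) ha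
      set k := expTop a (t + 1)
      rw [Nat.choose_succ_succ'] at h3
      have h4 := plusPlus_le_choose (show a - k.choose (t + 1) < k.choose t by omega)
      have h5 := choose_add_lexFree_le h1 h4
      have h6 := ih (a - k.choose (t + 1))
      have h7 : (k + 1).choose (t + 1 + 1) = k.choose (t + 1) + k.choose (t + 1 + 1) :=
        Nat.choose_succ_succ' _ _
      show (k + 1).choose (t + 1 + 1) + _ ≤ a + lexFree (t + 1 + 1) ((k + 1).choose (t + 1 + 1) + _)
      change k.choose (t + 1 + 1) + _ ≤ lexFree (t + 1 + 1) ((k + 1).choose (t + 1 + 1) + _) at h5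
      omega

/-- A degree-`t+1` lex segment of admissible size divides into the previous one. -/
theorem sub_lexFree_le_of_le_plusPlus {a b t : ℕ} (h : b ≤ plusPlus a t) :
    b - lexFree (t + 1) b ≤ a := by
  have h1 := sub_lexFree_mono (t + 1) h
  have h2 := plusPlus_le_add_lexFree a t
  simp only at h1
  omega

/-! ## Sets of exponent vectors -/

section ExponentVectors

variable {v : ℕ}

/-- The exponent vector with first entry `a` and remaining entries `u`. -/
def consV (a : ℕ) (u : Fin v → ℕ) : Fin (v + 1) → ℕ := Fin.cons a u

theorem exists_eq_consV (m : Fin (v + 1) → ℕ) : ∃ a u, m = consV a u :=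
  ⟨m 0, Fin.tail m, (Fin.cons_self_tail m).symm⟩

@[simp] theorem consV_zero (a : ℕ) (u : Fin v → ℕ) : consV a u 0 = a := rfl

@[simp] theorem consV_succ (a : ℕ) (u : Fin v → ℕ) (i : Fin v) : consV a u i.succ = u i := rfl

@[simp] theorem tail_consV (a : ℕ) (u : Fin v → ℕ) : Fin.tail (consV a u) = u := rfl

@[simp] theorem sum_consV (a : ℕ) (u : Fin v → ℕ) : ∑ i, consV a u i = a + ∑ i, u i := by
  simp [Fin.sum_univ_succ]

theorem consV_add_single_zero (a : ℕ) (u : Fin v → ℕ) :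
    consV a u + Pi.single 0 1 = consV (a + 1) u := by
  funext j
  refine Fin.cases ?_ (fun j => ?_) j <;> simp

theorem consV_add_single_succ (a : ℕ) (u : Fin v → ℕ) (i : Fin v) :
    consV a u + Pi.single i.succ 1 = consV a (u + Pi.single i 1) := by
  funext j
  refine Fin.cases ?_ (fun j => ?_) j
  · simp
  · simp [Pi.single_apply]

theorem consV_injective (a : ℕ) : Function.Injective (consV a : (Fin v → ℕ) → _) :=
  Fin.cons_right_injective (α := fun _ => ℕ) a

theorem sum_add_single (m : Fin v → ℕ) (i : Fin v) :
    ∑ j, (m + Pi.single i 1 : Fin v → ℕ) j = ∑ j, m j + 1 := by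
  simp [Finset.sum_add_distrib]

theorem exists_eq_add_single {m : Fin v → ℕ} {i : Fin v} (h : 1 ≤ m i) :
    ∃ w : Fin v → ℕ, m = w + Pi.single i 1 := by
  refine ⟨m - Pi.single i 1, (tsub_add_cancel_of_le fun j => ?_).symm⟩
  by_cases hj : j = i
  · subst hj; simpa using h
  · simp [hj]

/-- Replacing a variable by a smaller one does not leave the set. -/
def LowerBorel (C : Set (Fin v → ℕ)) : Prop :=
  ∀ (m : Fin v → ℕ) (i j : Fin v), j < i → m + Pi.single i 1 ∈ C → m + Pi.single j 1 ∈ C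

/-- The set is closed under division by variables. -/
def OrderIdeal (C : Set (Fin v → ℕ)) : Prop :=
  ∀ (m : Fin v → ℕ) (i : Fin v), m + Pi.single i 1 ∈ C → m ∈ C

/-- The set can be prolonged from degree `t` by every variable not exceeding the support. -/
def Prolongs (C : Set (Fin v → ℕ)) (t : ℕ) : Prop :=
  ∀ m : Fin v → ℕ, ∑ j, m j = t → m ∈ C → ∀ i : Fin v, (∀ j < i, m j = 0) → m + Pi.single i 1 ∈ C

/-- The number of elements of degree `t`. -/
noncomputable def degCount (C : Set (Fin v → ℕ)) (t : ℕ) : ℕ :=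
  Set.ncard {m : Fin v → ℕ | ∑ i, m i = t ∧ m ∈ C}

/-- The elements not involving the smallest variable. -/
def freePart (C : Set (Fin (v + 1) → ℕ)) : Set (Fin v → ℕ) := {u | consV 0 u ∈ C}

/-- The quotients by the smallest variable. -/
def colonPart (C : Set (Fin (v + 1) → ℕ)) : Set (Fin (v + 1) → ℕ) :=
  {m | m + Pi.single 0 1 ∈ C}

theorem finite_degree (t : ℕ) : {m : Fin v → ℕ | ∑ i, m i = t}.Finite := by
  refine (Set.finite_Iic (fun _ : Fin v => t)).subset fun m hm i => ?_
  rw [← (show ∑ i, m i = t from hm)]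
  exact Finset.single_le_sum (fun _ _ => Nat.zero_le _) (Finset.mem_univ i)

theorem finite_degCount (C : Set (Fin v → ℕ)) (t : ℕ) :
    {m : Fin v → ℕ | ∑ i, m i = t ∧ m ∈ C}.Finite :=
  (finite_degree t).subset fun _ h => h.1

theorem degCount_congr {C D : Set (Fin v → ℕ)} {t : ℕ}
    (h : ∀ m, ∑ i, m i = t → (m ∈ C ↔ m ∈ D)) : degCount C t = degCount D t := by
  unfold degCount
  congr 1
  ext m
  exact and_congr_right (h m)

theorem degCount_mono {C D : Set (Fin v → ℕ)} {t : ℕ}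
    (h : ∀ m, ∑ i, m i = t → m ∈ C → m ∈ D) : degCount C t ≤ degCount D t :=
  Set.ncard_le_ncard (fun m hm => ⟨hm.1, h m hm.1 hm.2⟩) (finite_degCount D t)

theorem exists_mem_notMem_of_degCount_lt {C D : Set (Fin v → ℕ)} {t : ℕ}
    (h : degCount C t < degCount D t) : ∃ m, ∑ i, m i = t ∧ m ∈ D ∧ m ∉ C := by
  by_contra! hcon
  exact absurd (degCount_mono hcon) (not_le.2 h)

theorem degCount_zero (C : Set (Fin v → ℕ)) : degCount C 0 = if 0 ∈ C then 1 else 0 := by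
  have h : {m : Fin v → ℕ | ∑ i, m i = 0 ∧ m ∈ C} = if 0 ∈ C then {0} else ∅ := by
    ext m
    have : ∑ i, m i = 0 ↔ m = 0 := by simp [funext_iff]
    simp only [Set.mem_ofPred_eq, this]
    split_ifs with h0
    · simp only [Set.mem_singleton_iff, and_iff_left_iff_imp]
      rintro rfl; exact h0
    · simp only [Set.mem_empty_iff_false, iff_false, not_and]
      rintro rfl; exact h0
  unfold degCount
  rw [h]
  split_ifs <;> simp

theorem degCount_succ_fin_zero (C : Set (Fin 0 → ℕ)) (t : ℕ) : degCount C (t + 1) = 0 := by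
  simp [degCount]

theorem degCount_split (C : Set (Fin (v + 1) → ℕ)) (t : ℕ) :
    degCount C (t + 1) = degCount (freePart C) (t + 1) + degCount (colonPart C) t := by
  have h : {m : Fin (v + 1) → ℕ | ∑ i, m i = t + 1 ∧ m ∈ C} =
      consV 0 '' {u : Fin v → ℕ | ∑ i, u i = t + 1 ∧ u ∈ freePart C} ∪
      (· + Pi.single 0 1) '' {m : Fin (v + 1) → ℕ | ∑ i, m i = t ∧ m ∈ colonPart C} := by
    ext m
    constructor
    · rintro ⟨hm, hC⟩
      obtain ⟨a, u, rfl⟩ := exists_eq_consV m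
      rw [sum_consV] at hm
      rcases a with _ | a
      · exact Or.inl ⟨u, ⟨by omega, hC⟩, rfl⟩
      · rw [← consV_add_single_zero] at hC ⊢
        exact Or.inr ⟨consV a u, ⟨by rw [sum_consV]; omega, hC⟩, rfl⟩
    · rintro (⟨u, ⟨hu, hC⟩, rfl⟩ | ⟨m, ⟨hm, hC⟩, rfl⟩)
      · exact ⟨by rw [sum_consV, hu, zero_add], hC⟩
      · exact ⟨by rw [sum_add_single, hm], hC⟩
  unfold degCount
  rw [h, Set.ncard_union_eq ?_ ((finite_degCount _ _).image _) ((finite_degCount _ _).image _),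
    Set.ncard_image_of_injective _ (consV_injective 0),
    Set.ncard_image_of_injective _ (add_left_injective _)]
  rw [Set.disjoint_left]
  rintro _ ⟨u, -, rfl⟩ ⟨m, -, hm⟩
  have := congrFun hm 0
  simp at this

theorem LowerBorel.freePart {C : Set (Fin (v + 1) → ℕ)} (h : LowerBorel C) :
    LowerBorel (freePart C) := by
  intro m i j hij hm
  have := h (consV 0 m) i.succ j.succ (Fin.succ_lt_succ_iff.2 hij)
  simp only [consV_add_single_succ] at this
  exact this hm

theorem LowerBorel.colonPart {C : Set (Fin (v + 1) → ℕ)} (h : LowerBorel C) :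
    LowerBorel (colonPart C) := by
  intro m i j hij hm
  have := h (m + Pi.single 0 1) i j hij
  simp only [add_right_comm m (Pi.single 0 1)] at this
  exact this hm

theorem OrderIdeal.freePart {C : Set (Fin (v + 1) → ℕ)} (h : OrderIdeal C) :
    OrderIdeal (freePart C) := by
  intro m i hm
  have := h (consV 0 m) i.succ
  rw [consV_add_single_succ] at this
  exact this hm

theorem Prolongs.freePart {C : Set (Fin (v + 1) → ℕ)} {t : ℕ} (h : Prolongs C t) :
    Prolongs (freePart C) t := by
  intro m hm hC i hi
  have := h (consV 0 m) (by simpa using hm) hC i.succ ?_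
  · rwa [consV_add_single_succ] at this
  · intro j
    refine Fin.cases (fun _ => rfl) (fun j hj => hi j (Fin.succ_lt_succ_iff.1 hj)) j

theorem zero_mem_freePart {C : Set (Fin (v + 1) → ℕ)} : 0 ∈ freePart C ↔ 0 ∈ C := by
  show consV 0 0 ∈ C ↔ _
  rw [show consV 0 0 = (0 : Fin (v + 1) → ℕ) by
    funext j; refine Fin.cases rfl (fun _ => rfl) j]

/-- Among Borel sets of given size, lex segments have the largest part free of the smallest
variable. -/
theorem degCount_freePart_le {C : Set (Fin (v + 1) → ℕ)} (hC : LowerBorel C) (t : ℕ) :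
    degCount (freePart C) t ≤ lexFree t (degCount C t) := by
  induction v generalizing t with
  | zero =>
    cases t with
    | zero =>
      simp only [degCount_zero, lexFree]
      exact le_of_eq (if_congr zero_mem_freePart rfl rfl)
    | succ t => rw [degCount_succ_fin_zero]; exact Nat.zero_le _
  | succ v ihv =>
    induction t generalizing C with
    | zero =>
      simp only [degCount_zero, lexFree]
      exact le_of_eq (if_congr zero_mem_freePart rfl rfl)
    | succ t iht =>
      rw [degCount_split C]
      refine le_lexFree_add ?_
      have h1 := ihv hC.freePart (t + 1)
      have h2 := degCount_split (freePart C) t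
      have h3 : degCount (colonPart (freePart C)) t ≤ degCount (freePart (colonPart C)) t := by
        refine degCount_mono fun u _ hu => ?_
        have hu' : consV 0 (u + Pi.single 0 1) ∈ C := hu
        rw [← consV_add_single_succ] at hu'
        exact hC _ _ 0 (Fin.succ_pos 0) hu'
      have h4 := iht hC.colonPart
      omega

/-! ### Growth vectors -/

/-- The number of elements of degree `t + 1` whose smallest variable is the `i`-th one. -/
noncomputable def growth : {v : ℕ} → Set (Fin v → ℕ) → ℕ → ℕ → ℕ
  | 0, _, _, _ => 0
  | _ + 1, C, t, 0 => degCount (colonPart C) t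
  | _ + 1, C, t, i + 1 => growth (freePart C) t i

theorem growth_eq_zero (C : Set (Fin v → ℕ)) (t : ℕ) {i : ℕ} (hi : v ≤ i) : growth C t i = 0 := by
  induction v generalizing i with
  | zero => rw [growth]
  | succ v ih =>
    obtain ⟨i, rfl⟩ : ∃ k, i = k + 1 := ⟨i - 1, by omega⟩
    rw [growth]
    exact ih _ (by omega)

theorem growth_succ_le {C : Set (Fin v → ℕ)} (hC : LowerBorel C) (t i : ℕ) :
    growth C t (i + 1) ≤ lexFree t (growth C t i) := by
  induction i generalizing v with
  | zero =>
    rcases v with _ | _ | v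
    · simp [growth]
    · simp [growth]
    · rw [growth, growth, growth]
      refine le_trans (degCount_mono fun u _ hu => ?_) (degCount_freePart_le hC.colonPart t)
      have hu' : consV 0 (u + Pi.single 0 1) ∈ C := hu
      rw [← consV_add_single_succ] at hu'
      exact hC _ _ 0 (Fin.succ_pos 0) hu'
  | succ i ih =>
    cases v with
    | zero => simp [growth]
    | succ v =>
      rw [growth, growth]
      exact ih hC.freePart

theorem degCount_succ_eq_sum (C : Set (Fin v → ℕ)) (t : ℕ) {B : ℕ} (hB : v ≤ B) :
    degCount C (t + 1) = ∑ i ∈ Finset.range B, growth C t i := by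
  induction v generalizing B with
  | zero => simp [degCount_succ_fin_zero, growth]
  | succ v ih =>
    obtain ⟨B, rfl⟩ : ∃ k, B = k + 1 := ⟨B - 1, by omega⟩
    rw [degCount_split, Finset.sum_range_succ', ih (freePart C) (by omega : v ≤ B)]
    simp only [growth]

theorem growth_zero_eq {C : Set (Fin v → ℕ)} (hC : OrderIdeal C) {t : ℕ}
    (hp : Prolongs C (t + 1)) : growth C (t + 1) 0 = degCount C (t + 1) := by
  cases v with
  | zero => rw [growth, degCount_succ_fin_zero]
  | succ v =>
    rw [growth]
    exact degCount_congr fun m hm => ⟨hC m 0, fun h => hp m hm h 0 fun j hj => absurd hj (by simp)⟩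

theorem growth_succ_eq {C : Set (Fin v → ℕ)} (hC : OrderIdeal C) {t : ℕ}
    (hp : Prolongs C (t + 1)) (i : ℕ) :
    growth C (t + 1) i = growth C t i + growth C (t + 1) (i + 1) := by
  induction i generalizing v with
  | zero =>
    cases v with
    | zero => simp [growth]
    | succ v =>
      rw [growth_zero_eq hC hp, degCount_split, growth, growth,
        growth_zero_eq hC.freePart hp.freePart, add_comm]
  | succ i ih =>
    cases v with
    | zero => simp [growth]
    | succ v =>
      simp only [growth]
      rw [ih hC.freePart hp.freePart]

end ExponentVectors

/-! ## Lex segments -/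

section LexSegments

variable {v : ℕ}

/-- `lexIn m a` holds if `m` is among the `a` lex-smallest exponent vectors of its degree
(provided `a` does not exceed the bounds of `degCount_lexIn`). -/
noncomputable def lexIn : {v : ℕ} → (Fin v → ℕ) → ℕ → Prop
  | 0, _, a => 1 ≤ a
  | _ + 1, m, a =>
    Nat.rec (motive := fun _ => ℕ → Prop)
      (fun a => lexIn (Fin.tail m) (lexFree (∑ i, Fin.tail m i) a))
      (fun e F a => F (a - lexFree (e + 1 + ∑ i, Fin.tail m i) a)) (m 0) a

theorem lexIn_consV_zero (u : Fin v → ℕ) (a : ℕ) :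
    lexIn (consV 0 u) a ↔ lexIn u (lexFree (∑ i, u i) a) := Iff.rfl

theorem lexIn_consV_succ (e : ℕ) (u : Fin v → ℕ) (a : ℕ) :
    lexIn (consV (e + 1) u) a ↔ lexIn (consV e u) (a - lexFree (∑ i, consV e u i + 1) a) := by
  rw [sum_consV, add_right_comm]
  rfl

theorem lexIn_add_single_zero (m : Fin (v + 1) → ℕ) (a : ℕ) :
    lexIn (m + Pi.single 0 1) a ↔ lexIn m (a - lexFree (∑ i, m i + 1) a) := by
  obtain ⟨e, u, rfl⟩ := exists_eq_consV m
  rw [consV_add_single_zero, lexIn_consV_succ]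

theorem lexIn_mono {m : Fin v → ℕ} {a b : ℕ} (hab : a ≤ b) (h : lexIn m a) : lexIn m b := by
  induction v generalizing a b with
  | zero => exact le_trans (show 1 ≤ a from h) hab
  | succ v ih =>
    obtain ⟨e, u, rfl⟩ := exists_eq_consV m
    induction e generalizing a b with
    | zero => exact ih (lexFree_mono _ hab) h
    | succ e ihe =>
      rw [lexIn_consV_succ] at h ⊢
      exact ihe (sub_lexFree_mono _ hab) h

theorem lexIn_of_add_single {m : Fin v → ℕ} {i : Fin v} {a : ℕ}
    (h : lexIn (m + Pi.single i 1) a) : lexIn m (a - lexFree (∑ j, m j + 1) a) := by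
  induction v generalizing a with
  | zero => exact i.elim0
  | succ v ih =>
    revert h
    refine Fin.cases (fun h => (lexIn_add_single_zero m a).1 h) (fun i h => ?_) i
    obtain ⟨e, u, rfl⟩ := exists_eq_consV m
    induction e generalizing a with
    | zero =>
      rw [consV_add_single_succ, lexIn_consV_zero, sum_add_single] at h
      rw [sum_consV, zero_add, lexIn_consV_zero]
      exact lexIn_mono (sub_lexFree_lexFree_le _ a) (ih h)
    | succ e ihe =>
      rw [consV_add_single_succ, lexIn_consV_succ, ← consV_add_single_succ, sum_add_single] at h
      rw [lexIn_consV_succ]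
      have := ihe h
      rw [← consV_add_single_zero, sum_add_single]
      exact this

theorem lowerBorel_lexIn (a : ℕ) : LowerBorel {m : Fin v → ℕ | lexIn m a} := by
  induction v generalizing a with
  | zero => exact fun _ i => i.elim0
  | succ v ih =>
    intro m i j hij
    obtain ⟨i, rfl⟩ := Fin.exists_succ_eq.2 (Fin.ne_zero_of_lt hij)
    revert hij
    refine Fin.cases (fun _ h => (lexIn_add_single_zero m a).2 (lexIn_of_add_single h))
      (fun j hij => ?_) j
    obtain ⟨e, u, rfl⟩ := exists_eq_consV m
    induction e generalizing a with
    | zero =>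
      simp only [consV_add_single_succ, Set.mem_ofPred_eq, lexIn_consV_zero, sum_add_single]
      exact ih _ u i j (Fin.succ_lt_succ_iff.1 hij)
    | succ e ihe =>
      simp only [consV_add_single_succ, Set.mem_ofPred_eq, lexIn_consV_succ]
      simp only [← consV_add_single_succ, sum_add_single]
      exact ihe _

/-- Bound on the size of a lex segment of degree `t` that makes it automatically fit into the
monomials in `v` variables. -/
def Fits (v t a : ℕ) : Prop := (t = 0 ∧ a ≤ 1) ∨ (t ≠ 0 ∧ a ≤ v)

theorem Fits.lexFree {t a : ℕ} (h : Fits (v + 1) t a) : Fits v t (lexFree t a) := by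
  rcases h with ⟨rfl, h⟩ | ⟨ht, h⟩
  · exact Or.inl ⟨rfl, h⟩
  · obtain ⟨t, rfl⟩ : ∃ k, t = k + 1 := ⟨t - 1, by omega⟩
    refine Or.inr ⟨ht, ?_⟩
    rcases Nat.eq_zero_or_pos a with rfl | ha
    · rw [lexFree_zero_right]; exact Nat.zero_le _
    · have := lexFree_lt t ha
      omega

theorem Fits.mono {t a b : ℕ} (h : Fits v t b) (hab : a ≤ b) : Fits v t a :=
  h.imp (And.imp_right hab.trans) (And.imp_right hab.trans)

theorem degCount_lexIn {t a : ℕ} (h : Fits v t a) :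
    degCount {m : Fin v → ℕ | lexIn m a} t = a := by
  induction v generalizing t a with
  | zero =>
    rcases h with ⟨rfl, h⟩ | ⟨ht, h⟩
    · rw [degCount_zero]
      have h0 : (0 : Fin 0 → ℕ) ∈ {m : Fin 0 → ℕ | lexIn m a} ↔ 1 ≤ a := Iff.rfl
      simp only [h0]
      split_ifs <;> omega
    · obtain ⟨t, rfl⟩ : ∃ k, t = k + 1 := ⟨t - 1, by omega⟩
      rw [degCount_succ_fin_zero]
      omega
  | succ v ihv =>
    induction t generalizing a with
    | zero =>
      have := ihv h.lexFree
      rw [degCount_zero] at this ⊢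
      have h0 : (0 : Fin v → ℕ) ∈ freePart {m : Fin (v + 1) → ℕ | lexIn m a} ↔
          0 ∈ {m : Fin v → ℕ | lexIn m (lexFree 0 a)} := by
        show lexIn (consV 0 (0 : Fin v → ℕ)) a ↔ lexIn (0 : Fin v → ℕ) (lexFree 0 a)
        rw [lexIn_consV_zero]
        simp
      rw [← zero_mem_freePart]
      simp only [h0]
      exact this
    | succ t iht =>
      have hle := lexFree_le (t + 1) a
      have h1 : degCount (freePart {m : Fin (v + 1) → ℕ | lexIn m a}) (t + 1) =
          lexFree (t + 1) a := by
        refine Eq.trans (degCount_congr fun m hm => ?_) (ihv h.lexFree)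
        show lexIn (consV 0 m) a ↔ _
        rw [lexIn_consV_zero, hm, Set.mem_ofPred_eq]
      have h2 : degCount (colonPart {m : Fin (v + 1) → ℕ | lexIn m a}) t =
          a - lexFree (t + 1) a := by
        have hfit : Fits (v + 1) t (a - lexFree (t + 1) a) := by
          rcases h with ⟨ht, -⟩ | ⟨-, h⟩
          · omega
          · rcases t with _ | t
            · rw [zero_add, lexFree_one_left]
              exact Or.inl ⟨rfl, by omega⟩
            · exact Or.inr ⟨by omega, by omega⟩
        refine Eq.trans (degCount_congr fun m hm => ?_) (iht hfit)
        show lexIn (m + Pi.single 0 1) a ↔ _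
        rw [lexIn_add_single_zero, hm, Set.mem_ofPred_eq]
      rw [degCount_split, h1, h2]
      omega

/-! ### Growth-lexicographic sets -/

/-- `growthLexIn m c` holds if `m` lies in the growth-lexicographic set with growth vector `c`. -/
noncomputable def growthLexIn : {v : ℕ} → (Fin v → ℕ) → (ℕ → ℕ) → Prop
  | 0, _, _ => False
  | _ + 1, m, c =>
    if m 0 = 0 then growthLexIn (Fin.tail m) (fun i => c (i + 1))
    else lexIn (consV (m 0 - 1) (Fin.tail m)) (c 0)

theorem growthLexIn_consV_zero (u : Fin v → ℕ) (c : ℕ → ℕ) :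
    growthLexIn (consV 0 u) c ↔ growthLexIn u (fun i => c (i + 1)) := by
  rw [growthLexIn, if_pos (consV_zero 0 u), tail_consV]

theorem growthLexIn_add_single_zero (m : Fin (v + 1) → ℕ) (c : ℕ → ℕ) :
    growthLexIn (m + Pi.single 0 1) c ↔ lexIn m (c 0) := by
  obtain ⟨e, u, rfl⟩ := exists_eq_consV m
  rw [consV_add_single_zero, growthLexIn, if_neg (by simp), tail_consV, consV_zero,
    Nat.add_sub_cancel]

theorem lexIn_of_growthLexIn_add_single {t : ℕ} {c : ℕ → ℕ}
    (hc : ∀ i, c (i + 1) ≤ lexFree t (c i)) {m : Fin v → ℕ} (hm : ∑ j, m j = t) {i : Fin v}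
    (h : growthLexIn (m + Pi.single i 1) c) : lexIn m (c 0) := by
  induction v generalizing c with
  | zero => exact i.elim0
  | succ v ih =>
    revert h
    refine Fin.cases (fun h => (growthLexIn_add_single_zero m c).1 h) (fun i h => ?_) i
    obtain ⟨e, u, rfl⟩ := exists_eq_consV m
    cases e with
    | zero =>
      rw [consV_add_single_succ, growthLexIn_consV_zero] at h
      rw [sum_consV, zero_add] at hm
      rw [lexIn_consV_zero, hm]
      exact lexIn_mono (hc 0) (ih (fun i => hc (i + 1)) hm h)
    | succ e =>
      rw [← consV_add_single_zero, add_right_comm, growthLexIn_add_single_zero] at h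
      rw [← consV_add_single_zero, lexIn_add_single_zero]
      exact lexIn_of_add_single h

theorem growthLexIn_lowerBorel {t : ℕ} {c : ℕ → ℕ}
    (hc : ∀ i, c (i + 1) ≤ lexFree t (c i)) {m : Fin v → ℕ} (hm : ∑ j, m j = t) {i j : Fin v}
    (hij : j < i) (h : growthLexIn (m + Pi.single i 1) c) : growthLexIn (m + Pi.single j 1) c := by
  induction v generalizing c with
  | zero => exact i.elim0
  | succ v ih =>
    obtain ⟨i, rfl⟩ := Fin.exists_succ_eq.2 (Fin.ne_zero_of_lt hij)
    revert hij
    refine Fin.cases (fun _ => (growthLexIn_add_single_zero m c).2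
      (lexIn_of_growthLexIn_add_single hc hm h)) (fun j hij => ?_) j
    obtain ⟨e, u, rfl⟩ := exists_eq_consV m
    cases e with
    | zero =>
      rw [consV_add_single_succ, growthLexIn_consV_zero] at h ⊢
      rw [sum_consV, zero_add] at hm
      exact ih (fun i => hc (i + 1)) hm (Fin.succ_lt_succ_iff.1 hij) h
    | succ e =>
      rw [← consV_add_single_zero, add_right_comm, growthLexIn_add_single_zero] at h ⊢
      exact lowerBorel_lexIn (c 0) _ _ _ hij h

theorem growth_congr {C D : Set (Fin v → ℕ)} {t : ℕ}
    (h : ∀ m, ∑ i, m i = t + 1 → (m ∈ C ↔ m ∈ D)) (i : ℕ) : growth C t i = growth D t i := by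
  induction i generalizing v with
  | zero =>
    cases v with
    | zero => rfl
    | succ v => exact degCount_congr fun m hm => h _ (by rw [sum_add_single, hm])
  | succ i ih =>
    cases v with
    | zero => rfl
    | succ v => exact ih fun m hm => h _ (by rw [sum_consV, hm, zero_add])

theorem growth_growthLexIn {t : ℕ} {c : ℕ → ℕ} (hc : ∀ i < v, Fits (v - i) t (c i)) {i : ℕ}
    (hi : i < v) : growth {m : Fin v → ℕ | growthLexIn m c} t i = c i := by
  induction v generalizing c i with
  | zero => omega
  | succ v ih =>
    cases i with
    | zero =>
      rw [growth]
      refine (degCount_congr fun m hm => ?_).trans (degCount_lexIn (hc 0 hi))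
      exact growthLexIn_add_single_zero m c
    | succ i =>
      rw [growth]
      refine Eq.trans ?_ (ih (c := fun i => c (i + 1)) (i := i) (fun i hi => ?_) (by omega))
      · exact growth_congr (fun m _ => growthLexIn_consV_zero m c) i
      · have := hc (i + 1) (by omega)
        rwa [Nat.add_sub_add_right] at this

/-! ### Minimal monomials outside a set -/

theorem exists_growth_lt {C : Set (Fin v → ℕ)} (hB : LowerBorel C) (hO : OrderIdeal C) {t : ℕ}
    {m : Fin v → ℕ} (hm : ∑ j, m j = t + 1) (hmC : m ∉ C)
    (hs : ∀ (w : Fin v → ℕ) (i : Fin v), m = w + Pi.single i 1 → w ∈ C) :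
    ∃ i < v, growth C t i < (lexFree t)^[i] (degCount C t) := by
  induction v with
  | zero => simp at hm
  | succ v ih =>
    obtain ⟨e, u, rfl⟩ := exists_eq_consV m
    cases e with
    | zero =>
      obtain ⟨i, hi, h⟩ := ih hB.freePart hO.freePart (by simpa using hm) hmC
        (fun w i hw => hs (consV 0 w) i.succ (by rw [consV_add_single_succ, hw]))
      refine ⟨i + 1, by omega, lt_of_lt_of_le h ?_⟩
      rw [Function.iterate_succ_apply]
      exact (lexFree_mono t).iterate i (degCount_freePart_le hB t)
    | succ e =>
      refine ⟨0, by omega, ?_⟩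
      rw [← consV_add_single_zero] at hm hmC hs
      rw [sum_add_single] at hm
      refine Set.ncard_lt_ncard ⟨fun m h => ⟨h.1, hO m 0 h.2⟩, fun hsub => ?_⟩
        (finite_degCount C t)
      exact hmC (hsub ⟨Nat.succ_injective hm, hs _ 0 rfl⟩).2

theorem exists_minimal_of_lt {t : ℕ} {c : ℕ → ℕ} {a i : ℕ} (hi : i < v) (ha : Fits v t a)
    (h : c i < (lexFree t)^[i] a) :
    ∃ m : Fin v → ℕ, ∑ j, m j = t + 1 ∧ ¬ growthLexIn m c ∧
      ∀ (w : Fin v → ℕ) (j : Fin v), m = w + Pi.single j 1 → lexIn w a := by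
  induction v generalizing c a i with
  | zero => omega
  | succ v ih =>
    cases i with
    | zero =>
      have h' : c 0 < a := h
      obtain ⟨w, hw, hwa, hwc⟩ := exists_mem_notMem_of_degCount_lt
        (C := {m : Fin (v + 1) → ℕ | lexIn m (c 0)}) (D := {m : Fin (v + 1) → ℕ | lexIn m a})
        (t := t) (by rwa [degCount_lexIn ha, degCount_lexIn (ha.mono h'.le)])
      refine ⟨w + Pi.single 0 1, by rw [sum_add_single, hw], ?_, fun w' j hj => ?_⟩
      · rwa [growthLexIn_add_single_zero]
      · rcases eq_or_ne j 0 with rfl | hj0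
        · rwa [← add_left_injective _ hj]
        · have h1 : 1 ≤ w' 0 := by
            have := congrFun hj 0
            simp [hj0.symm] at this
            omega
          obtain ⟨x, rfl⟩ := exists_eq_add_single h1
          rw [add_right_comm] at hj
          rw [add_left_injective _ hj] at hwa
          exact lowerBorel_lexIn a _ _ _ (Fin.pos_of_ne_zero hj0) hwa
    | succ i =>
      obtain ⟨u, hu, hg, hs⟩ := ih (c := fun i => c (i + 1)) (a := lexFree t a) (i := i)
        (by omega) ha.lexFree h
      refine ⟨consV 0 u, by rw [sum_consV, hu, zero_add],
        by rwa [growthLexIn_consV_zero], fun w j => ?_⟩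
      obtain ⟨e, w, rfl⟩ := exists_eq_consV w
      refine Fin.cases (fun hj => ?_) (fun j hj => ?_) j
      · have := congrFun hj 0
        simp at this
      · rw [consV_add_single_succ] at hj
        have he : 0 = e := by simpa using congrFun hj 0
        subst he
        have hj' := consV_injective 0 hj
        rw [hj', sum_add_single] at hu
        rw [lexIn_consV_zero, Nat.succ_injective hu]
        exact hs w j hj'

end LexSegments

/-! ## Order ideals with prescribed growth -/

section Lifting

variable {v : ℕ}

/-- Every element of degree `t` outside `C` is divisible by an element of degree `t - 1`
outside `C`. -/
def NoMinimalOutside (C : Set (Fin v → ℕ)) (t : ℕ) : Prop :=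
  ∀ m : Fin v → ℕ, ∑ j, m j = t → m ∉ C →
    ∃ (w : Fin v → ℕ) (i : Fin v), m = w + Pi.single i 1 ∧ w ∉ C

theorem NoMinimalOutside.prolongs {C : Set (Fin v → ℕ)} {t : ℕ} (hB : LowerBorel C)
    (h : NoMinimalOutside C (t + 1)) : Prolongs C t := by
  intro m hm hC i hi
  by_contra hcon
  obtain ⟨w, k, hw, hwC⟩ := h _ (by rw [sum_add_single, hm]) hcon
  rcases eq_or_ne k i with rfl | hki
  · rw [add_left_injective _ hw] at hC
    exact hwC hC
  · have h1 : m k ≠ 0 := by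
      have := congrFun hw k
      simp [hki] at this
      omega
    have h2 : i < k := lt_of_le_of_ne (not_lt.1 fun hk => h1 (hi k hk)) hki.symm
    have h3 : 1 ≤ w i := by
      have := congrFun hw i
      simp [hki.symm] at this
      omega
    obtain ⟨x, rfl⟩ := exists_eq_add_single h3
    rw [add_right_comm] at hw
    rw [add_left_injective _ hw] at hC
    exact hwC (hB x k i h2 hC)

theorem growth_eq_of_prolongs {w : ℕ} {C : Set (Fin v → ℕ)} {D : Set (Fin w → ℕ)}
    (hC : OrderIdeal C) (hD : OrderIdeal D) {t : ℕ} (hpC : ∀ k, t < k → Prolongs C k)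
    (hpD : ∀ k, t < k → Prolongs D k) (h : ∀ i, growth C t i = growth D t i) {k : ℕ}
    (hk : t ≤ k) : ∀ i, growth C k i = growth D k i := by
  induction k, hk using Nat.le_induction with
  | base => exact h
  | succ k hk ih =>
    have key : ∀ j i, max v w ≤ i + j → growth C (k + 1) i = growth D (k + 1) i := by
      intro j
      induction j with
      | zero =>
        intro i hi
        rw [growth_eq_zero C _ (by omega), growth_eq_zero D _ (by omega)]
      | succ j ihj =>
        intro i hi
        rw [growth_succ_eq hC (hpC _ (by omega)), growth_succ_eq hD (hpD _ (by omega)), ih i,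
          ihj (i + 1) (by omega)]
    exact fun i => key (max v w) i (by omega)

theorem degCount_eq_of_prolongs {w : ℕ} {C : Set (Fin v → ℕ)} {D : Set (Fin w → ℕ)}
    (hC : OrderIdeal C) (hD : OrderIdeal D) {t : ℕ} (hpC : ∀ k, t < k → Prolongs C k)
    (hpD : ∀ k, t < k → Prolongs D k) (h : ∀ i, growth C t i = growth D t i) {k : ℕ}
    (hk : t < k) : degCount C k = degCount D k := by
  obtain ⟨k, rfl⟩ : ∃ l, k = l + 1 := ⟨k - 1, by omega⟩
  rw [degCount_succ_eq_sum C k (le_max_left v w), degCount_succ_eq_sum D k (le_max_right v w)]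
  exact Finset.sum_congr rfl fun i _ => growth_eq_of_prolongs hC hD hpC hpD h (by omega) i

/-- The set consisting of the lex segments of sizes `H k` in degrees `k ≤ t`, and of the
monomials in higher degrees all of whose divisors of degree `t + 1` lie in the
growth-lexicographic set with growth vector `c`. -/
def liftSet (v t : ℕ) (H c : ℕ → ℕ) : Set (Fin v → ℕ) :=
  {m | (∑ i, m i ≤ t → lexIn m (H (∑ i, m i))) ∧
    ∀ u ≤ m, ∑ i, u i = t + 1 → growthLexIn u c}

theorem eq_of_le_of_sum_le {u m : Fin v → ℕ} (h : u ≤ m) (hs : ∑ i, m i ≤ ∑ i, u i) : u = m := by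
  have := (Finset.sum_eq_sum_iff_of_le fun i (_ : i ∈ Finset.univ) => h i).1
    (le_antisymm (Finset.sum_le_sum fun i _ => h i) hs)
  exact funext fun i => this i (Finset.mem_univ i)

variable {t : ℕ} {H c : ℕ → ℕ}

theorem mem_liftSet_of_le {m : Fin v → ℕ} (hm : ∑ i, m i ≤ t) :
    m ∈ liftSet v t H c ↔ lexIn m (H (∑ i, m i)) := by
  refine ⟨fun h => h.1 hm, fun h => ⟨fun _ => h, fun u hu hut => ?_⟩⟩
  have := Finset.sum_le_sum fun i (_ : i ∈ Finset.univ) => hu i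
  omega

theorem mem_liftSet_of_eq {m : Fin v → ℕ} (hm : ∑ i, m i = t + 1) :
    m ∈ liftSet v t H c ↔ growthLexIn m c := by
  refine ⟨fun h => h.2 m le_rfl hm, fun h => ⟨fun _ => by omega, fun u hu hut => ?_⟩⟩
  rwa [eq_of_le_of_sum_le hu (by omega)]

theorem le_or_exists_of_le_add_single {u m : Fin v → ℕ} {i : Fin v} (h : u ≤ m + Pi.single i 1) :
    u ≤ m ∨ ∃ w ≤ m, u = w + Pi.single i 1 := by
  by_cases hu : u i ≤ m i
  · refine Or.inl fun j => ?_
    have := h j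
    rcases eq_or_ne j i with rfl | hj
    · exact hu
    · simpa [hj] using this
  · obtain ⟨w, rfl⟩ := exists_eq_add_single (m := u) (i := i) (by omega)
    exact Or.inr ⟨w, fun j => by simpa using h j, rfl⟩

theorem le_add_single (m : Fin v → ℕ) (i : Fin v) : m ≤ m + Pi.single i 1 :=
  fun j => by simp

theorem lowerBorel_liftSet (hc : ∀ i, c (i + 1) ≤ lexFree t (c i)) :
    LowerBorel (liftSet v t H c) := by
  rintro m i j hij ⟨h1, h2⟩
  refine ⟨fun hs => ?_, fun u hu hut => ?_⟩
  · rw [sum_add_single] at hs h1 ⊢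
    exact lowerBorel_lexIn _ _ _ _ hij (h1 hs)
  · rcases le_or_exists_of_le_add_single hu with hu | ⟨w, hw, rfl⟩
    · exact h2 u (hu.trans (le_add_single m i)) hut
    · rw [sum_add_single] at hut
      refine growthLexIn_lowerBorel hc (Nat.succ_injective hut) hij
        (h2 _ (fun k => ?_) (by rw [sum_add_single, hut]))
      simpa using hw k

theorem orderIdeal_liftSet (hc : ∀ i, c (i + 1) ≤ lexFree t (c i)) (hc0 : c 0 ≤ H t)
    (hH : ∀ k < t, H (k + 1) - lexFree (k + 1) (H (k + 1)) ≤ H k) :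
    OrderIdeal (liftSet v t H c) := by
  rintro m i ⟨h1, h2⟩
  refine ⟨fun hs => ?_, fun u hu => h2 u (hu.trans (le_add_single m i))⟩
  rw [sum_add_single] at h1
  rcases hs.lt_or_eq with hs | hs
  · exact lexIn_mono (hH _ hs) (lexIn_of_add_single (h1 hs))
  · have := h2 _ le_rfl (by rw [sum_add_single, hs])
    rw [hs]
    exact lexIn_mono hc0 (lexIn_of_growthLexIn_add_single hc hs this)

theorem noMinimalOutside_liftSet {k : ℕ} (hk : t + 1 < k) :
    NoMinimalOutside (liftSet v t H c) k := by
  intro m hm hmK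
  obtain ⟨u, hu, hut, huc⟩ : ∃ u ≤ m, ∑ i, u i = t + 1 ∧ ¬ growthLexIn u c := by
    by_contra! hcon
    exact hmK ⟨fun h => by omega, hcon⟩
  obtain ⟨l, -, hl⟩ := Finset.exists_lt_of_sum_lt (s := Finset.univ) (f := u) (g := m)
    (by rw [hut, hm]; exact hk)
  obtain ⟨w, rfl⟩ := exists_eq_add_single (m := m) (i := l) (by omega)
  refine ⟨w, l, rfl, fun hw => huc (hw.2 u (fun j => ?_) hut)⟩
  rcases eq_or_ne j l with rfl | hj
  · simp at hl; omega
  · simpa [hj] using hu j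

theorem degCount_liftSet_of_le {k : ℕ} (hk : k ≤ t) (hf : Fits v k (H k)) :
    degCount (liftSet v t H c) k = H k := by
  refine Eq.trans (degCount_congr fun m hm => ?_) (degCount_lexIn hf)
  rw [mem_liftSet_of_le (by omega), hm, Set.mem_ofPred_eq]

theorem growth_liftSet (hc : ∀ i < v, Fits (v - i) t (c i)) {i : ℕ} (hi : i < v) :
    growth (liftSet v t H c) t i = c i :=
  (growth_congr (fun _ hm => mem_liftSet_of_eq hm) i).trans (growth_growthLexIn hc hi)

end Lifting

/-! ## Monomial ideals -/

section Ideals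

variable {n : ℕ}

theorem shrinkAt_add_single (w : Mon n) (i : Fin (n + 1)) :
    shrinkAt (w + Pi.single i 1) i = w := by
  funext l
  rcases eq_or_ne l i with rfl | h
  · simp [shrinkAt]
  · simp [shrinkAt, h]

theorem borelStep_add_single (w : Mon n) {i j : Fin (n + 1)} (h : j ≠ i) :
    borelStep (w + Pi.single j 1) j i = w + Pi.single i 1 := by
  funext l
  rcases eq_or_ne l j with rfl | hj
  · simp [borelStep, h]
  · rcases eq_or_ne l i with rfl | hi
    · simp [borelStep, hj]
    · simp [borelStep, hj, hi]

theorem isMinGen_iff {J : Set (Mon n)} {m : Mon n} :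
    IsMinGen J m ↔ m ∈ J ∧ ∀ (w : Mon n) (i : Fin (n + 1)), m = w + Pi.single i 1 → w ∉ J := by
  refine and_congr_right fun _ => ⟨fun h w i hm => ?_, fun h i hi => ?_⟩
  · subst hm
    have := h i (by simp)
    rwa [shrinkAt_add_single] at this
  · obtain ⟨w, rfl⟩ := exists_eq_add_single hi
    rw [shrinkAt_add_single]
    exact h w i rfl

theorem hilb_eq_degCount (J : Set (Mon n)) (t : ℕ) : hilb J t = degCount Jᶜ t := rfl

theorem monIdeal_iff {J : Set (Mon n)} : MonIdeal J ↔ OrderIdeal Jᶜ := by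
  refine ⟨fun h m i hm hJ => hm (h m hJ _), fun h m hm m' => ?_⟩
  generalize hs : ∑ i, m' i = s
  induction s generalizing m' with
  | zero =>
    have : m' = 0 := by simpa [funext_iff] using hs
    rwa [this, add_zero]
  | succ s ih =>
    obtain ⟨i, -, hi⟩ := Finset.exists_ne_zero_of_sum_ne_zero (hs.trans_ne (Nat.succ_ne_zero s))
    obtain ⟨w, rfl⟩ := exists_eq_add_single (m := m') (i := i) (by omega)
    rw [sum_add_single] at hs
    have h1 := ih w (by omega)
    by_contra hcon
    rw [← add_assoc] at hcon
    exact h _ _ hcon h1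

theorem stronglyStable_iff {J : Set (Mon n)} :
    StronglyStable J ↔ OrderIdeal Jᶜ ∧ LowerBorel Jᶜ := by
  rw [StronglyStable, monIdeal_iff]
  refine and_congr_right fun _ => ⟨fun h m i j hij hm hJ => hm ?_, fun h m hm j i hij hj => ?_⟩
  · have := h _ hJ j i hij (by simp)
    rwa [borelStep_add_single m hij.ne] at this
  · obtain ⟨w, rfl⟩ := exists_eq_add_single hj
    rw [borelStep_add_single w hij.ne]
    by_contra hcon
    exact h w i j hij hcon hm

theorem addAt_eq (m : Mon n) (i : Fin (n + 1)) (k : ℕ) :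
    (fun l => if l = i then m l + k else m l) = m + Pi.single i k := by
  funext l
  rcases eq_or_ne l i with rfl | h
  · simp
  · simp [h]

theorem colonPart_compl_of_saturated {J : Set (Mon n)} (hJ : StronglyStable J)
    (hs : monSat J = J) : colonPart Jᶜ = Jᶜ := by
  refine Set.Subset.antisymm (fun m hm => (stronglyStable_iff.1 hJ).1 m 0 hm) fun m hm h => hm ?_
  rw [← hs]
  intro i
  refine ⟨1, ?_⟩
  rw [addAt_eq]
  rcases eq_or_ne i 0 with rfl | hi
  · exact h
  · by_contra hcon
    exact (stronglyStable_iff.1 hJ).2 m i 0 (Fin.pos_of_ne_zero hi) hcon h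

theorem saturated_of_colonPart {J : Set (Mon n)} (h : colonPart Jᶜ = Jᶜ) :
    monSat J = J := by
  refine Set.Subset.antisymm (fun m hm => ?_) fun m hm i =>
    ⟨0, by rwa [addAt_eq, Pi.single_zero, add_zero]⟩
  obtain ⟨k, hk⟩ := hm 0
  rw [addAt_eq] at hk
  induction k with
  | zero => rwa [Pi.single_zero, add_zero] at hk
  | succ k ih =>
    refine ih ?_
    by_contra hcon
    rw [← Set.mem_compl_iff, ← h] at hcon
    refine hcon ?_
    rwa [add_assoc, ← Pi.single_add]

theorem finite_minGens {J : Set (Mon n)} (hJ : MonIdeal J) : {m | IsMinGen J m}.Finite := by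
  refine WellQuasiOrderedLE.finite_of_isAntichain fun a ha b hb hne hab => ?_
  obtain ⟨l, hl⟩ : ∃ l, a l < b l := by
    by_contra! hcon
    exact hne (le_antisymm hab hcon)
  obtain ⟨w, rfl⟩ := exists_eq_add_single (m := b) (i := l) (by omega)
  have haw : a ≤ w := by
    intro j
    rcases eq_or_ne j l with rfl | hj
    · simp at hl; omega
    · simpa [hj] using hab j
  refine (isMinGen_iff.1 hb).2 w l rfl ?_
  rw [← add_tsub_cancel_of_le haw]
  exact hJ a ha.1 _

theorem degree_le_monReg {J : Set (Mon n)} (hJ : MonIdeal J) {m : Mon n} (hm : IsMinGen J m) :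
    mdeg m ≤ monReg J :=
  le_csSup ((finite_minGens hJ).image mdeg).bddAbove ⟨m, hm, rfl⟩

theorem exists_minGen_degree_monReg {J : Set (Mon n)} (hJ : MonIdeal J) (h : 0 < monReg J) :
    ∃ m, IsMinGen J m ∧ mdeg m = monReg J := by
  refine Nat.sSup_mem (s := {d | ∃ m : Mon n, IsMinGen J m ∧ mdeg m = d}) ?_
    ((finite_minGens hJ).image mdeg).bddAbove
  by_contra hcon
  rw [Set.not_nonempty_iff_eq_empty] at hcon
  rw [monReg, hcon] at h
  simp at h

theorem noMinimalOutside_iff {J : Set (Mon n)} {t : ℕ} :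
    NoMinimalOutside Jᶜ t ↔ ∀ m, IsMinGen J m → mdeg m ≠ t := by
  simp only [isMinGen_iff, NoMinimalOutside, mdeg, Set.mem_compl_iff, not_not]
  refine ⟨fun h m hm hmt => ?_, fun h m hmt hm => ?_⟩
  · obtain ⟨w, i, hw, hwJ⟩ := h m hmt hm.1
    exact hm.2 w i hw hwJ
  · by_contra! hcon
    exact h m ⟨hm, hcon⟩ hmt

end Ideals

/-! ## Functions that are polynomial from some point on -/

section PolynomialFrom

/-- The `k`-th difference of `u` vanishes from `s` on. -/
def DiffVanishes (s : ℕ) : ℕ → (ℕ → ℤ) → Prop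
  | 0, u => ∀ t, s ≤ t → u t = 0
  | k + 1, u => DiffVanishes s k fun t => u (t + 1) - u t

/-- `u` is polynomial from `s` on: some iterated difference vanishes there. -/
def PolyFrom (s : ℕ) (u : ℕ → ℤ) : Prop := ∃ k, DiffVanishes s k u

variable {s : ℕ}

theorem DiffVanishes.congr {k : ℕ} {u w : ℕ → ℤ} (h : ∀ t, s ≤ t → u t = w t)
    (hu : DiffVanishes s k u) : DiffVanishes s k w := by
  induction k generalizing u w with
  | zero => exact fun t ht => (h t ht).symm.trans (hu t ht)
  | succ k ih =>
    refine ih (fun t ht => ?_) hu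
    rw [h t ht, h (t + 1) (by omega)]

theorem DiffVanishes.add {k : ℕ} {u w : ℕ → ℤ} (hu : DiffVanishes s k u)
    (hw : DiffVanishes s k w) : DiffVanishes s k fun t => u t + w t := by
  induction k generalizing u w with
  | zero =>
    intro t ht
    show u t + w t = 0
    rw [hu t ht, hw t ht, add_zero]
  | succ k ih =>
    show DiffVanishes s k _
    exact (ih hu hw).congr fun t _ => by ring

theorem DiffVanishes.neg {k : ℕ} {u : ℕ → ℤ} (hu : DiffVanishes s k u) :
    DiffVanishes s k fun t => - u t := by
  induction k generalizing u with
  | zero =>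
    intro t ht
    show - u t = 0
    rw [hu t ht, neg_zero]
  | succ k ih =>
    show DiffVanishes s k _
    exact (ih hu).congr fun t _ => by ring

theorem DiffVanishes.comp_succ {k : ℕ} {u : ℕ → ℤ} (hu : DiffVanishes s k u) :
    DiffVanishes s k fun t => u (t + 1) := by
  induction k generalizing u with
  | zero => exact fun t ht => hu (t + 1) (by omega)
  | succ k ih => exact ih hu

theorem DiffVanishes.mono {k l : ℕ} (hkl : k ≤ l) {u : ℕ → ℤ} (hu : DiffVanishes s k u) :
    DiffVanishes s l u := by
  induction l, hkl using Nat.le_induction with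
  | base => exact hu
  | succ l _ ih =>
    show DiffVanishes s l _
    exact (ih.comp_succ.add ih.neg).congr fun t _ => (sub_eq_add_neg _ _).symm

theorem PolyFrom.add {u w : ℕ → ℤ} (hu : PolyFrom s u) (hw : PolyFrom s w) :
    PolyFrom s fun t => u t + w t := by
  obtain ⟨k, hk⟩ := hu
  obtain ⟨l, hl⟩ := hw
  exact ⟨max k l, (hk.mono (le_max_left k l)).add (hl.mono (le_max_right k l))⟩

theorem PolyFrom.sub {u w : ℕ → ℤ} (hu : PolyFrom s u) (hw : PolyFrom s w) :
    PolyFrom s fun t => u t - w t := by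
  obtain ⟨l, hl⟩ := hw
  simpa only [sub_eq_add_neg] using hu.add ⟨l, hl.neg⟩

theorem PolyFrom.sum {ι : Type*} (I : Finset ι) {u : ι → ℕ → ℤ} (h : ∀ i ∈ I, PolyFrom s (u i)) :
    PolyFrom s fun t => ∑ i ∈ I, u i t := by
  induction I using Finset.induction_on with
  | empty => exact ⟨0, fun _ _ => rfl⟩
  | insert i I hi ih =>
    simp only [Finset.sum_insert hi]
    exact (h i (Finset.mem_insert_self i I)).add (ih fun j hj => h j (Finset.mem_insert_of_mem hj))

theorem PolyFrom.congr {u w : ℕ → ℤ} (h : ∀ t, s ≤ t → u t = w t) (hu : PolyFrom s u) :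
    PolyFrom s w :=
  hu.imp fun _ hk => hk.congr h

/-- A function that is polynomial from `s` on and eventually vanishes is zero from `s` on. -/
theorem PolyFrom.eq_zero {u : ℕ → ℤ} (hu : PolyFrom s u) {N : ℕ} (hN : ∀ t, N ≤ t → u t = 0)
    {t : ℕ} (ht : s ≤ t) : u t = 0 := by
  obtain ⟨k, hk⟩ := hu
  induction k generalizing u t with
  | zero => exact hk t ht
  | succ k ih =>
    have h1 : ∀ t, s ≤ t → u (t + 1) - u t = 0 := fun t ht =>
      ih (u := fun t => u (t + 1) - u t)
        (fun t ht => by rw [hN t ht, hN (t + 1) (by omega), sub_zero]) ht hk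
    have h2 : ∀ j, u (t + j) = u t := by
      intro j
      induction j with
      | zero => rfl
      | succ j ihj =>
        have := h1 (t + j) (by omega)
        rw [← ihj, ← sub_eq_zero, ← this, add_assoc]
    rw [← h2 N]
    exact hN _ (by omega)

theorem PolyFrom.eq_of_eventually_eq {u w : ℕ → ℤ} (hu : PolyFrom s u) (hw : PolyFrom s w) {N : ℕ}
    (hN : ∀ t, N ≤ t → u t = w t) {t : ℕ} (ht : s ≤ t) : u t = w t :=
  sub_eq_zero.1 ((hu.sub hw).eq_zero (fun t ht => sub_eq_zero.2 (hN t ht)) ht)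

theorem polyFrom_growth {v : ℕ} {C : Set (Fin v → ℕ)} (hC : OrderIdeal C)
    (hp : ∀ k, s < k → Prolongs C k) (i : ℕ) :
    PolyFrom s fun k => (growth C k i : ℤ) := by
  have key : ∀ j i, v ≤ i + j → DiffVanishes s j fun k => (growth C k i : ℤ) := by
    intro j
    induction j with
    | zero => intro i hi k _; simp [growth_eq_zero C k (show v ≤ i by omega)]
    | succ j ih =>
      intro i hi
      show DiffVanishes s j _
      refine (ih (i + 1) (by omega)).comp_succ.congr fun k hk => ?_
      show (growth C (k + 1) (i + 1) : ℤ) = growth C (k + 1) i - growth C k i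
      rw [growth_succ_eq hC (hp (k + 1) (by omega)) i]
      push_cast
      ring
  exact ⟨v, key v i (by omega)⟩

theorem polyFrom_degCount {v : ℕ} {C : Set (Fin v → ℕ)} (hC : OrderIdeal C)
    (hp : ∀ k, s < k → Prolongs C k) :
    PolyFrom s fun k => (degCount C (k + 1) : ℤ) := by
  simp only [degCount_succ_eq_sum C _ le_rfl, Nat.cast_sum]
  exact PolyFrom.sum _ fun i _ => polyFrom_growth hC hp i

end PolynomialFrom

/-! ## Hilbert polynomials -/

theorem zchoose_zero_right (a : ℤ) : zchoose a 0 = 1 := by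
  simp [zchoose]

theorem zchoose_succ_succ (a : ℤ) (k : ℕ) :
    zchoose (a + 1) (k + 1) = zchoose a (k + 1) + zchoose a k := by
  rcases lt_trichotomy a (-1) with ha | rfl | ha
  · obtain ⟨b, rfl⟩ : ∃ b : ℕ, a = -(b + 2) := ⟨(-a - 2).toNat, by omega⟩
    rw [zchoose, zchoose, zchoose, if_neg (by omega), if_neg (by omega), if_neg (by omega)]
    rw [show (((k + 1 : ℕ) : ℤ) - 1 - (-((b : ℤ) + 2) + 1)).toNat = k + b + 1 by omega,
      show (((k + 1 : ℕ) : ℤ) - 1 - (-((b : ℤ) + 2))).toNat = k + b + 1 + 1 by omega,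
      show ((k : ℤ) - 1 - (-((b : ℤ) + 2))).toNat = k + b + 1 by omega,
      Nat.choose_succ_succ' (k + b + 1) k]
    push_cast
    ring
  · have h : (((k + 1 : ℕ) : ℤ) - 1 - (-1)).toNat = k + 1 := by omega
    have h' : ((k : ℤ) - 1 - (-1)).toNat = k := by omega
    rw [zchoose, zchoose, zchoose, if_pos (by omega), if_neg (by omega), if_neg (by omega), h, h',
      Nat.choose_self, Nat.choose_self]
    simp [pow_succ]
  · obtain ⟨b, rfl⟩ : ∃ b : ℕ, a = b := ⟨a.toNat, by omega⟩
    rw [zchoose, zchoose, zchoose, if_pos (by omega), if_pos (by omega), if_pos (by omega),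
      show ((b : ℤ) + 1).toNat = b + 1 by omega, Int.toNat_natCast, Nat.choose_succ_succ']
    push_cast
    ring

theorem diffVanishes_zchoose (s k : ℕ) (c : ℤ) :
    DiffVanishes s (k + 1) fun t => zchoose (t + c) k := by
  induction k with
  | zero => intro t _; simp [zchoose_zero_right]
  | succ k ih =>
    show DiffVanishes s (k + 1) fun t : ℕ =>
      zchoose ((t + 1 : ℕ) + c) (k + 1) - zchoose (t + c) (k + 1)
    refine DiffVanishes.congr (fun t _ => ?_) ih
    have := zchoose_succ_succ (t + c) k
    rw [show ((t + 1 : ℕ) : ℤ) + c = t + c + 1 by push_cast; ring, this]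
    ring

theorem polyFrom_eval (p : GotzmannPoly) (s : ℕ) (c : ℤ) : PolyFrom s fun t => p.eval (t + c) := by
  refine PolyFrom.sum _ fun i _ => ⟨_, (diffVanishes_zchoose s (p.ks.getD i 0)
    (c + (p.ks.getD i 0 : ℤ) - i)).congr fun t _ => ?_⟩
  congr 1
  ring

/-- The polynomial with Gotzmann exponents `L`, with the shifts starting at `o`. -/
def evalList : List ℕ → ℤ → ℤ → ℤ
  | [], _, _ => 0
  | k :: L, o, z => zchoose (z + k - o) k + evalList L (o + 1) z

theorem evalList_eq_sum (L : List ℕ) (o z : ℤ) :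
    evalList L o z =
      ∑ i ∈ Finset.range L.length, zchoose (z + (L.getD i 0 : ℤ) - (o + i)) (L.getD i 0) := by
  induction L generalizing o with
  | nil => rfl
  | cons k L ih =>
    rw [evalList, ih, List.length_cons, Finset.sum_range_succ', add_comm]
    congr 1
    · refine Finset.sum_congr rfl fun i _ => ?_
      rw [List.getD_cons_succ]
      push_cast
      congr 1
      ring
    · simp

theorem GotzmannPoly.eval_eq_evalList (p : GotzmannPoly) (z : ℤ) :
    p.eval z = evalList p.ks 0 z := by
  rw [evalList_eq_sum]
  simp only [zero_add]
  rfl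

theorem evalList_sub (L : List ℕ) (hL : L.Pairwise (· ≥ ·)) (o z : ℤ) :
    evalList ((L.filter fun k => 1 ≤ k).map fun k => k - 1) o z =
      evalList L o z - evalList L o (z - 1) := by
  induction L generalizing o with
  | nil => simp [evalList]
  | cons k L ih =>
    have ih' := ih hL.of_cons
    cases k with
    | zero =>
      have h0 : ∀ k ∈ L, k = 0 := fun k hk => Nat.le_zero.1 (List.rel_of_pairwise_cons hL hk)
      have h1 : L.filter (fun k => 1 ≤ k) = [] := by
        rw [List.filter_eq_nil_iff]
        intro k hk
        simp [h0 k hk]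
      rw [h1] at ih'
      have := ih' (o + 1)
      simp only [List.map_nil, evalList] at this
      simp [h1, evalList, zchoose_zero_right]
      linarith
    | succ k =>
      have h := zchoose_succ_succ (z + k - o) k
      simp only [List.filter_cons_of_pos, Nat.le_add_left, decide_true, List.map_cons,
        Nat.add_sub_cancel, evalList, ih']
      rw [show z + ((k + 1 : ℕ) : ℤ) - o = z + k - o + 1 by push_cast; ring,
        show z - 1 + ((k + 1 : ℕ) : ℤ) - o = z + k - o by push_cast; ring, h]
      ring

theorem GotzmannPoly.delta_eval (p : GotzmannPoly) (z : ℤ) :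
    p.delta.eval z = p.eval z - p.eval (z - 1) := by
  simp only [GotzmannPoly.eval_eq_evalList]
  exact evalList_sub p.ks p.sorted 0 z

/-! ## The ideal of the cone -/

section Cone

variable {v : ℕ} {K : Set (Fin v → ℕ)}

/-- The extension to one more (smallest) variable of the monomial ideal with complement `K`. -/
def coneIdeal (K : Set (Fin v → ℕ)) : Set (Mon v) := {m | Fin.tail m ∉ K}

theorem consV_mem_compl_coneIdeal {a : ℕ} {u : Fin v → ℕ} :
    consV a u ∈ (coneIdeal K)ᶜ ↔ u ∈ K :=
  not_not

theorem stronglyStable_coneIdeal (hO : OrderIdeal K) (hB : LowerBorel K) :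
    StronglyStable (coneIdeal K) := by
  rw [stronglyStable_iff]
  constructor
  · intro m i
    obtain ⟨a, u, rfl⟩ := exists_eq_consV m
    refine Fin.cases ?_ (fun i => ?_) i
    · rw [consV_add_single_zero, consV_mem_compl_coneIdeal, consV_mem_compl_coneIdeal]
      exact id
    · rw [consV_add_single_succ, consV_mem_compl_coneIdeal, consV_mem_compl_coneIdeal]
      exact hO u i
  · intro m i j hij
    obtain ⟨a, u, rfl⟩ := exists_eq_consV m
    obtain ⟨i, rfl⟩ := Fin.exists_succ_eq.2 (Fin.ne_zero_of_lt hij)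
    rw [consV_add_single_succ, consV_mem_compl_coneIdeal]
    revert hij
    refine Fin.cases (fun _ h => ?_) (fun j hij h => ?_) j
    · rw [consV_add_single_zero, consV_mem_compl_coneIdeal]
      exact hO u i h
    · rw [consV_add_single_succ, consV_mem_compl_coneIdeal]
      exact hB u i j (Fin.succ_lt_succ_iff.1 hij) h

theorem colonPart_compl_coneIdeal : colonPart (coneIdeal K)ᶜ = (coneIdeal K)ᶜ := by
  ext m
  obtain ⟨a, u, rfl⟩ := exists_eq_consV m
  show consV a u + Pi.single 0 1 ∈ (coneIdeal K)ᶜ ↔ _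
  rw [consV_add_single_zero, consV_mem_compl_coneIdeal, consV_mem_compl_coneIdeal]

theorem freePart_compl_coneIdeal : freePart (coneIdeal K)ᶜ = K :=
  Set.ext fun _ => consV_mem_compl_coneIdeal

theorem hilb_coneIdeal_zero : hilb (coneIdeal K) 0 = degCount K 0 := by
  have h : (0 : Mon v) ∈ (coneIdeal K)ᶜ ↔ (0 : Fin v → ℕ) ∈ K := by
    rw [← zero_mem_freePart, freePart_compl_coneIdeal]
  rw [hilb_eq_degCount, degCount_zero, degCount_zero]
  by_cases h0 : (0 : Fin v → ℕ) ∈ K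
  · rw [if_pos (h.2 h0), if_pos h0]
  · rw [if_neg (mt h.1 h0), if_neg h0]

theorem hilb_coneIdeal_succ (t : ℕ) :
    hilb (coneIdeal K) (t + 1) = degCount K (t + 1) + hilb (coneIdeal K) t := by
  rw [hilb_eq_degCount, hilb_eq_degCount, degCount_split, freePart_compl_coneIdeal,
    colonPart_compl_coneIdeal]

theorem monReg_coneIdeal (hO : OrderIdeal K) (hB : LowerBorel K) {s : ℕ}
    (hs : ∀ k, s < k → NoMinimalOutside K k)
    (hm : ∃ u : Fin v → ℕ, ∑ i, u i = s ∧ u ∉ K ∧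
      ∀ (w : Fin v → ℕ) (j : Fin v), u = w + Pi.single j 1 → w ∈ K) :
    monReg (coneIdeal K) = s := by
  have hI := (stronglyStable_coneIdeal hO hB).1
  refine le_antisymm ?_ ?_
  · by_contra! hcon
    obtain ⟨m, hm, hd⟩ := exists_minGen_degree_monReg hI (by omega)
    rw [← hd] at hcon
    obtain ⟨hmI, hmin⟩ := isMinGen_iff.1 hm
    obtain ⟨a, u, rfl⟩ := exists_eq_consV m
    have hu : u ∉ K := hmI
    cases a with
    | zero =>
      rw [mdeg, sum_consV, zero_add] at hcon
      obtain ⟨w, i, rfl, hw⟩ := hs _ hcon u rfl hu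
      exact hmin (consV 0 w) i.succ (consV_add_single_succ 0 w i).symm hw
    | succ a => exact hmin (consV a u) 0 (consV_add_single_zero a u).symm hu
  · obtain ⟨u, hus, huK, hu⟩ := hm
    have hd : mdeg (consV 0 u) = s := by rw [mdeg, sum_consV, zero_add, hus]
    rw [← hd]
    refine degree_le_monReg hI (isMinGen_iff.2 ⟨huK, fun w i => ?_⟩)
    obtain ⟨a, w, rfl⟩ := exists_eq_consV w
    refine Fin.cases (fun hw => ?_) (fun i hw => ?_) i
    · have := congrFun hw 0
      simp at this
    · rw [consV_add_single_succ] at hw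
      have ha : 0 = a := by simpa using congrFun hw 0
      subst ha
      exact consV_mem_compl_coneIdeal.2 (hu w i (consV_injective 0 hw))

end Cone

/-- If `u` is polynomial from `s` on, and eventually agrees with the difference of a
Hilbert polynomial, then it agrees with it from there on. -/
theorem eval_eq_of_polyFrom {p : GotzmannPoly} {u : ℕ → ℤ} {s N : ℕ}
    (hu : PolyFrom s fun k => u (k + 1))
    (hN : ∀ t, N ≤ t → u (t + 1) = p.eval (t + 1) - p.eval t) {t : ℕ} (ht : s ≤ t) :
    u (t + 1) = p.eval (t + 1) - p.eval t :=
  hu.eq_of_eventually_eq (w := fun t : ℕ => p.eval (t + 1) - p.eval t)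
    ((polyFrom_eval p s 1).sub (by simpa using polyFrom_eval p s 0)) hN ht

/-- Theorem `construction`, expanded lifting.
Let `f ∈ F(p,ρ)` and let `g` be the Hilbert function of a closed projective subscheme with
Hilbert polynomial `Δp` such that `g ⪯ Δf`. Then there is a closed projective subscheme `X`
with Hilbert function `f` and `reg(X) = max{reg(Z), ρ+1}`; in ideal-theoretic form: for
every saturated strongly stable ideal `J'` whose quotient has Hilbert function `g`, there
exist `n'` and a saturated strongly stable ideal `I` of `K[x₀,…,x_{n'}]` whose quotient has
Hilbert function `f` and with `reg(I) = max{reg(J'), ρ+1}`. -/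
theorem statement16 (p : GotzmannPoly) (hr : 1 < p.r) (ρ : ℕ)
    (f : ℕ → ℤ) (hf : f ∈ Fset p ρ)
    (g : ℕ → ℤ) (hg : OSeq g ∧ OSeq (nderiv g)) (hgHP : HasHP p.delta g)
    (hle : ∀ t : ℕ, g t ≤ nderiv f t) :
    ∀ (n : ℕ) (J' : Set (Mon n)), StronglyStable J' → monSat J' = J' →
      (∀ t : ℕ, (hilb J' t : ℤ) = g t) →
      ∃ (n' : ℕ) (I : Set (Mon n')), StronglyStable I ∧ monSat I = I ∧
        (∀ t : ℕ, (hilb I t : ℤ) = f t) ∧ monReg I = max (monReg J') (ρ + 1) := by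
  intro n J' hJ hsat hhilb
  obtain ⟨⟨-, hf0, -⟩, ⟨hh0, -, hh⟩, hreg, hmin⟩ := hf
  obtain ⟨t, ht⟩ : ∃ t, max (monReg J') (ρ + 1) = t + 1 :=
    ⟨max (monReg J') (ρ + 1) - 1, by omega⟩
  obtain ⟨hCO, hCB⟩ := stronglyStable_iff.1 hJ
  have hCcolon := colonPart_compl_of_saturated hJ hsat
  have hCg : ∀ k, (degCount J'ᶜ k : ℤ) = g k := hhilb
  set C := J'ᶜ with hC
  set H : ℕ → ℕ := fun k => (nderiv f k).toNat with hHdef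
  have hHf : ∀ k, (H k : ℤ) = nderiv f k := fun k => Int.toNat_of_nonneg (hh0 k)
  have hH0 : H 0 = 1 := rfl
  set c : ℕ → ℕ := growth C t with hcdef
  have hc : ∀ i, c (i + 1) ≤ lexFree t (c i) := growth_succ_le hCB t
  have hCH : ∀ k, degCount C k ≤ H k := fun k => by
    have := hle k
    rw [← hCg, ← hHf] at this
    exact_mod_cast this
  have hc0 : c 0 ≤ H t := by
    refine le_trans (le_of_eq ?_) (hCH t)
    rw [hcdef, growth, hCcolon]
  have hHt : ∀ k < t, H (k + 1) - lexFree (k + 1) (H (k + 1)) ≤ H k := by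
    intro k _
    rcases k with _ | k
    · rw [zero_add, lexFree_one_left, hH0]
      omega
    · refine sub_lexFree_le_of_le_plusPlus ?_
      have := hh (k + 1) (by omega)
      rw [← hHf] at this
      exact_mod_cast this
  obtain ⟨v, hv, hvH⟩ : ∃ v, n + 2 ≤ v ∧ ∀ k ≤ t, H k ≤ v := by
    refine ⟨n + 2 + ∑ k ∈ Finset.range (t + 1), H k, by omega, fun k hk => ?_⟩
    have : H k ≤ ∑ k ∈ Finset.range (t + 1), H k :=
      Finset.single_le_sum (fun _ _ => Nat.zero_le _) (Finset.mem_range.2 (Nat.lt_succ_of_le hk))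
    omega
  have hfits : ∀ k ≤ t, Fits v k (H k) := by
    intro k hk
    rcases Nat.eq_zero_or_pos k with rfl | hk0
    · exact Or.inl ⟨rfl, hH0.le⟩
    · exact Or.inr ⟨hk0.ne', hvH k hk⟩
  have hcfits : ∀ i < v, Fits (v - i) t (c i) := by
    intro i _
    rcases Nat.eq_zero_or_pos t with ht0 | ht0
    · refine Or.inl ⟨ht0, ?_⟩
      have h1 : c i ≤ c 0 := by
        induction i with
        | zero => exact le_rfl
        | succ i ih => exact (hc i).trans ((lexFree_le t _).trans (ih (by omega)))
      rw [ht0, hH0] at hc0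
      exact h1.trans hc0
    · refine Or.inr ⟨ht0.ne', ?_⟩
      have h1 : c i = 0 ∨ c i + i ≤ c 0 := by
        induction i with
        | zero => exact Or.inr le_rfl
        | succ i ih =>
          have h2 := hc i
          rcases Nat.eq_zero_or_pos (c i) with h0 | h0
          · rw [h0, lexFree_zero_right] at h2
            omega
          · obtain ⟨l, rfl⟩ : ∃ l, t = l + 1 := ⟨t - 1, by omega⟩
            have h3 := lexFree_lt l h0
            have h4 := ih (by omega)
            omega
      have h2 := hvH t le_rfl
      omega
  set K := liftSet v t H c with hK
  have hKO : OrderIdeal K := orderIdeal_liftSet hc hc0 hHt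
  have hKB : LowerBorel K := lowerBorel_liftSet hc
  have hKmin : ∀ k, t + 1 < k → NoMinimalOutside K k := fun k hk => noMinimalOutside_liftSet hk
  have hpK : ∀ k, t < k → Prolongs K k := fun k hk => (hKmin (k + 1) (by omega)).prolongs hKB
  have hpC : ∀ k, t < k → Prolongs C k := by
    intro k hk
    refine NoMinimalOutside.prolongs hCB (noMinimalOutside_iff.2 fun m hm hmk => ?_)
    have := degree_le_monReg hJ.1 hm
    omega
  have hgrowth : ∀ i, growth K t i = growth C t i := by
    intro i
    by_cases hi : i < v
    · exact growth_liftSet hcfits hi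
    · rw [growth_eq_zero K t (not_lt.1 hi), growth_eq_zero C t (by omega)]
  have hpoly : ∀ k : ℕ, ρ ≤ k → nderiv f (k + 1) = p.eval (k + 1) - p.eval k := by
    intro k hk
    rw [nderiv, hreg k hk, hreg (k + 1) (by omega), Nat.cast_add_one]
  have hKH : ∀ k, degCount K k = H k := by
    intro k
    rcases Nat.lt_or_ge t k with hk | hk
    · obtain ⟨k, rfl⟩ : ∃ l, k = l + 1 := ⟨k - 1, by omega⟩
      rw [degCount_eq_of_prolongs hKO hCO hpK hpC hgrowth hk]
      have hu : PolyFrom t fun k => g (k + 1) := by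
        simpa only [hCg] using polyFrom_degCount hCO hpC
      obtain ⟨N, hN⟩ := hgHP
      have := eval_eq_of_polyFrom (p := p) hu (N := N) (fun j hj => by
        rw [hN (j + 1) (by omega), GotzmannPoly.delta_eval, Nat.cast_add_one, add_sub_cancel_right])
        (t := k) (by omega)
      rw [← hpoly k (by omega), ← hHf, ← hCg] at this
      exact_mod_cast this
    · exact degCount_liftSet_of_le hk (hfits k hk)
  have hgen : ∀ i < v, c i < (lexFree t)^[i] (H t) →
      ∃ u : Fin v → ℕ, ∑ i, u i = t + 1 ∧ u ∉ K ∧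
        ∀ (w : Fin v → ℕ) (j : Fin v), u = w + Pi.single j 1 → w ∈ K := by
    intro i hi hlt
    obtain ⟨u, hu, huc, huw⟩ := exists_minimal_of_lt hi (hfits t le_rfl) hlt
    refine ⟨u, hu, fun h => huc ((mem_liftSet_of_eq hu).1 h), fun w j hw => ?_⟩
    have hwt : ∑ i, w i = t := by
      rw [hw, sum_add_single] at hu
      exact Nat.succ_injective hu
    rw [hK, mem_liftSet_of_le hwt.le, hwt]
    exact huw w j hw
  refine ⟨v, coneIdeal K, stronglyStable_coneIdeal hKO hKB,
    saturated_of_colonPart colonPart_compl_coneIdeal, fun k => ?_, ?_⟩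
  · induction k with
    | zero => rw [hilb_coneIdeal_zero, hKH, hH0, hf0, Nat.cast_one]
    | succ k ih =>
      rw [hilb_coneIdeal_succ, Nat.cast_add, ih, hKH, hHf, nderiv, sub_add_cancel]
  · rw [ht]
    refine monReg_coneIdeal hKO hKB hKmin ?_
    rcases Nat.lt_or_ge ρ (monReg J') with hm | hm
    · obtain ⟨m, hmJ, hmd⟩ := exists_minGen_degree_monReg hJ.1 (by omega)
      obtain ⟨i, hi, hlt⟩ := exists_growth_lt (t := t) hCB hCO
        (show ∑ i, m i = t + 1 from hmd.trans (by omega)) (fun h => h hmJ.1)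
        (isMinGen_iff.1 hmJ).2
      exact hgen i (by omega) (hlt.trans_le ((lexFree_mono t).iterate i (hCH t)))
    · obtain rfl : t = ρ := by omega
      rcases Nat.eq_zero_or_pos t with ht0 | ht0
      · refine hgen (n + 1) (by omega) ?_
        rw [hcdef, growth_eq_zero C t le_rfl, ht0, hH0,
          show lexFree 0 = id from rfl, Function.iterate_id]
        exact one_pos
      · by_contra! hcon
        obtain ⟨l, rfl⟩ : ∃ l, t = l + 1 := ⟨t - 1, by omega⟩
        have hpK' : ∀ k, l < k → Prolongs K k := by
          intro k hk
          rcases (Nat.succ_le_of_lt hk).eq_or_lt with rfl | hk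
          · exact NoMinimalOutside.prolongs hKB hcon
          · exact hpK k hk
        have hu : PolyFrom l fun k => nderiv f (k + 1) := by
          simpa only [hKH, hHf] using polyFrom_degCount hKO hpK'
        have h1 := eval_eq_of_polyFrom hu hpoly le_rfl
        have h2 := hreg (l + 1) le_rfl
        rw [nderiv, h2, Nat.cast_add_one] at h1
        have h3 := hmin l fun k hk => by
          rcases hk.eq_or_lt with rfl | hk
          · linarith
          · exact hreg k hk
        omega
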